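/- arXiv:1712.06155 — 2 statements merged into one kernel-verified Lean document; each statement's English description precedes it below -/
import Mathlib

section
/- Assume that for every k with 1 ≤ k ≤ n, every GC_k set possesses a maximal line (the Gasca–Maeztu conjecture up to degree n). Let X be a GC_n set with n ≥ 1 and n ≠ 3, and let ℓ be an n-node line of X. Then the number of nodes of X that use ℓ equals binom(n,2) or equals binom(n-1,2), i.e., |X_ℓ| = n(n-1)/2 or |X_ℓ| = (n-1)(n-2)/2. -/
open MvPolynomial

/-- Points of the plane `ℝ²`. -/
abbrev Pt : Type := Fin 2 → ℝ

/-- Bivariate real polynomials. -/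
abbrev BPoly : Type := MvPolynomial (Fin 2) ℝ

/-- `X` is an `n`-poised node set: it has `N = (n+1)(n+2)/2` nodes and every
interpolation problem with polynomials of total degree at most `n` has a unique solution. -/
def IsPoised (n : ℕ) (X : Set Pt) : Prop :=
  X.ncard = (n + 1) * (n + 2) / 2 ∧
  ∀ c : Pt → ℝ, ∃! p : BPoly, p.totalDegree ≤ n ∧ ∀ A ∈ X, eval A p = c A

/-- `p` is an `n`-fundamental polynomial of the node `A` for the node set `X`. -/
def IsFund (n : ℕ) (X : Set Pt) (A : Pt) (p : BPoly) : Prop :=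
  p.totalDegree ≤ n ∧ eval A p = 1 ∧ ∀ B ∈ X, B ≠ A → eval B p = 0

/-- `X` is a `GC_n` set: it is `n`-poised and each node has a fundamental polynomial
that is a product of `n` polynomials of degree `1`. -/
def IsGC (n : ℕ) (X : Set Pt) : Prop :=
  IsPoised n X ∧
  ∀ A ∈ X, ∃ p : BPoly, IsFund n X A p ∧
    ∃ f : Fin n → BPoly, (∀ i, (f i).totalDegree = 1) ∧ p = ∏ i, f i

/-- A line is the zero set of a polynomial of degree exactly `1`. -/
def IsLine (L : Set Pt) : Prop :=
  ∃ f : BPoly, f.totalDegree = 1 ∧ L = {x : Pt | eval x f = 0}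

/-- A `k`-node line of `X`: a line passing through exactly `k` nodes of `X`. -/
def IsNodeLine (k : ℕ) (X : Set Pt) (L : Set Pt) : Prop :=
  IsLine L ∧ (X ∩ L).ncard = k

/-- A maximal line of an `n`-poised set `X`: an `(n+1)`-node line. -/
def IsMaxLine (n : ℕ) (X : Set Pt) (L : Set Pt) : Prop :=
  IsNodeLine (n + 1) X L

/-- The node `A` uses the line `L`: a degree-1 polynomial whose zero set is `L`
divides the `n`-fundamental polynomial of `A` with respect to `X`. -/
def Uses (n : ℕ) (X : Set Pt) (L : Set Pt) (A : Pt) : Prop :=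
  ∃ p f : BPoly, IsFund n X A p ∧ f.totalDegree = 1 ∧ L = {x : Pt | eval x f = 0} ∧ f ∣ p

/-- `X_ℓ`: the set of nodes of `X` that use the line `L`. -/
def UseSet (n : ℕ) (X : Set Pt) (L : Set Pt) : Set Pt :=
  {A ∈ X | Uses n X L A}

theorem eq_linear_of_totalDegree_le_one {f : BPoly} (hf : f.totalDegree ≤ 1) :
    ∃ a b c : ℝ, f = C a * X 0 + C b * X 1 + C c := by
  refine ⟨coeff (Finsupp.single 0 1) f, coeff (Finsupp.single 1 1) f, coeff 0 f, ?_⟩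
  ext s
  have hne (i : Fin 2) : (0 : Fin 2 →₀ ℕ) ≠ Finsupp.single i 1 := fun h => by
    simpa using DFunLike.congr_fun h i
  by_cases hs : s = 0 ∨ s = Finsupp.single 0 1 ∨ s = Finsupp.single 1 1
  · rcases hs with rfl | rfl | rfl <;>
      simp [coeff_C_mul, coeff_X, coeff_C, Finsupp.single_eq_single_iff, hne, (hne _).symm]
  · have h0 : coeff s f = 0 := by
      refine coeff_eq_zero_of_totalDegree_lt (lt_of_le_of_lt hf ?_)
      by_contra h2
      have h2 : s 0 + s 1 ≤ 1 := by
        rw [← Finsupp.degree_apply, Finsupp.degree_eq_sum] at h2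
        simpa using h2
      apply hs
      have : (s 0 = 0 ∧ s 1 = 0) ∨ (s 0 = 1 ∧ s 1 = 0) ∨ (s 0 = 0 ∧ s 1 = 1) := by omega
      rcases this with h | h | h
      · left; ext i; fin_cases i <;> simp [h.1, h.2]
      · right; left; ext i; fin_cases i <;> simp [h.1, h.2]
      · right; right; ext i; fin_cases i <;> simp [h.1, h.2]
    push Not at hs
    simp [coeff_C_mul, coeff_X, coeff_C, h0, hs.1.symm, hs.2.1.symm, hs.2.2.symm]

theorem exists_linear_of_totalDegree_eq_one {f : BPoly} (hf : f.totalDegree = 1) :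
    ∃ a b c : ℝ, f = C a * X 0 + C b * X 1 + C c ∧ (a ≠ 0 ∨ b ≠ 0) := by
  obtain ⟨a, b, c, h⟩ := eq_linear_of_totalDegree_le_one hf.le
  refine ⟨a, b, c, h, ?_⟩
  by_contra! hab
  rw [h, hab.1, hab.2] at hf
  simp at hf

theorem sub_aeval_mem_ideal (f : BPoly) (g : Fin 2 → BPoly)
    (hg : ∀ i, f ∣ X i - g i) (q : BPoly) : f ∣ q - aeval g q := by
  rw [← Ideal.mem_span_singleton, ← Ideal.Quotient.mk_eq_mk_iff_sub_mem]
  have : (Ideal.Quotient.mkₐ ℝ (Ideal.span {f})) =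
      (Ideal.Quotient.mkₐ ℝ (Ideal.span {f})).comp (aeval g) := by
    refine algHom_ext fun i => ?_
    simp only [AlgHom.comp_apply, aeval_X, Ideal.Quotient.mkₐ_eq_mk]
    rw [Ideal.Quotient.mk_eq_mk_iff_sub_mem, Ideal.mem_span_singleton]
    exact hg i
  exact DFunLike.congr_fun this q

theorem dvd_of_vanish {f q : BPoly} (hf : f.totalDegree = 1)
    (h : ∀ x, eval x f = 0 → eval x q = 0) : f ∣ q := by
  obtain ⟨a, b, c, rfl, hab⟩ := exists_linear_of_totalDegree_eq_one hf
  have key (g : Fin 2 → BPoly) (hg : ∀ i, (C a * X 0 + C b * X 1 + C c : BPoly) ∣ X i - g i)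
      (hz : ∀ x : Pt, a * eval x (g 0) + b * eval x (g 1) + c = 0) :
      (C a * X 0 + C b * X 1 + C c : BPoly) ∣ q := by
    have h1 := sub_aeval_mem_ideal _ g hg q
    have h2 : aeval g q = 0 := by
      refine MvPolynomial.funext fun x => ?_
      have : eval x (aeval g q) = eval (fun i => eval x (g i)) q := by
        rw [aeval_def, hom_eval₂, eval, ← coe_eval₂Hom]
        congr 2
        ext
        simp
      rw [this, map_zero]
      exact h _ (by simpa using hz x)
    rwa [h2, sub_zero] at h1
  rcases hab with ha | hb
  · refine key ![C (-a⁻¹) * (C b * X 1 + C c), X 1] ?_ ?_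
    · intro i
      fin_cases i
      · refine ⟨C a⁻¹, ?_⟩
        have : (C a * C a⁻¹ : BPoly) = 1 := by rw [← C_mul, mul_inv_cancel₀ ha, C_1]
        simp only [Fin.zero_eta, Matrix.cons_val_zero, C_neg]
        linear_combination (-X 0) * this
      · simp
    · intro x
      simp
      field_simp
      ring
  · refine key ![X 0, C (-b⁻¹) * (C a * X 0 + C c)] ?_ ?_
    · intro i
      fin_cases i
      · simp
      · refine ⟨C b⁻¹, ?_⟩
        have : (C b * C b⁻¹ : BPoly) = 1 := by rw [← C_mul, mul_inv_cancel₀ hb, C_1]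
        simp only [Fin.mk_one, Matrix.cons_val_one, Matrix.cons_val_zero, C_neg]
        linear_combination (-X 1) * this
    · intro x
      simp
      field_simp
      ring

theorem vanish_of_lt_ncard {f q : BPoly} {k : ℕ} (hf : f.totalDegree = 1)
    (hq : q.totalDegree ≤ k) {S : Set Pt} (hS : k < S.ncard)
    (hSf : ∀ x ∈ S, eval x f = 0) (hSq : ∀ x ∈ S, eval x q = 0) :
    ∀ x, eval x f = 0 → eval x q = 0 := by
  obtain ⟨a, b, c, rfl, hab⟩ := exists_linear_of_totalDegree_eq_one hf
  intro P hP
  have hP' : a * P 0 + b * P 1 + c = 0 := by simpa using hP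
  set g : Fin 2 → Polynomial ℝ :=
    ![Polynomial.C (P 0) + Polynomial.C b * Polynomial.X,
      Polynomial.C (P 1) + Polynomial.C (-a) * Polynomial.X] with hg
  have hdeg : (aeval g q).natDegree ≤ k * 1 := by
    refine aeval_natDegree_le q hq g fun i => ?_
    fin_cases i <;> simp only [hg, Fin.zero_eta, Fin.mk_one, Matrix.cons_val_zero,
      Matrix.cons_val_one] <;> compute_degree
  have hev (t : ℝ) : (aeval g q).eval t = eval (fun i => (g i).eval t) q := by
    rw [← Polynomial.coe_evalRingHom, aeval_def, hom_eval₂, eval, ← coe_eval₂Hom]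
    congr 2
    ext
    simp
  have hab' : a ^ 2 + b ^ 2 ≠ 0 := by
    intro h0
    have h1 : a = 0 := by nlinarith [sq_nonneg a, sq_nonneg b]
    have h2 : b = 0 := by nlinarith [sq_nonneg a, sq_nonneg b]
    simp [h1, h2] at hab
  set τ : Pt → ℝ := fun x => (b * (x 0 - P 0) - a * (x 1 - P 1)) / (a ^ 2 + b ^ 2) with hτ
  have hpt (x : Pt) (hx : x ∈ S) : (fun i => (g i).eval (τ x)) = x := by
    have hx' : a * x 0 + b * x 1 + c = 0 := by simpa using hSf x hx
    ext i
    fin_cases i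
    · simp [hg, hτ]
      field_simp
      linear_combination (-a) * hx' + a * hP'
    · simp [hg, hτ]
      field_simp
      linear_combination (-b) * hx' + b * hP'
  have hzero : aeval g q = 0 := by
    have hfin : S.Finite := Set.finite_of_ncard_pos (by omega)
    have hinj : Set.InjOn τ S := fun x hx y hy hxy => by
      rw [← hpt x hx, ← hpt y hy, hxy]
    refine Polynomial.eq_zero_of_natDegree_lt_card_of_eval_eq_zero' _ (hfin.image τ).toFinset ?_ ?_
    · intro t ht
      simp only [Set.Finite.mem_toFinset, Set.mem_image] at ht
      obtain ⟨x, hx, rfl⟩ := ht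
      rw [hev, hpt x hx, hSq x hx]
    · rw [← Set.ncard_eq_toFinset_card _ (hfin.image τ), hinj.ncard_image]
      omega
  have := hev 0
  rw [hzero] at this
  have h0 : (fun i => (g i).eval 0) = P := by
    ext i
    fin_cases i <;> simp [hg]
  rw [h0] at this
  simpa using this.symm

/-- `A` is separated from the other points of `Y` by a polynomial of degree at most `k`. -/
def IsSep (k : ℕ) (Y : Set Pt) (A : Pt) : Prop :=
  ∃ q : BPoly, q.totalDegree ≤ k ∧ eval A q ≠ 0 ∧ ∀ B ∈ Y, B ≠ A → eval B q = 0

theorem IsSep.mono {k : ℕ} {Y Y' : Set Pt} {A : Pt} (h : IsSep k Y A) (hY : Y' ⊆ Y) : IsSep k Y' A := by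
  obtain ⟨q, h1, h2, h3⟩ := h
  exact ⟨q, h1, h2, fun B hB => h3 B (hY hB)⟩

/-- A line with more than `k` points of `Y` can be split off from a separating polynomial. -/
theorem IsSep.remove {k : ℕ} {Y L : Set Pt} {A : Pt} (h : IsSep k Y A) (hL : IsLine L) (hA : A ∉ L)
    (hk : k < (Y ∩ L).ncard) : ∃ m, k = m + 1 ∧ IsSep m (Y \ L) A := by
  obtain ⟨q, h1, h2, h3⟩ := h
  obtain ⟨f, hf, rfl⟩ := hL
  have hv := vanish_of_lt_ncard hf h1 hk (fun x hx => hx.2) (fun x hx => h3 x hx.1 (by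
    rintro rfl; exact hA hx.2))
  obtain ⟨g, rfl⟩ := dvd_of_vanish hf hv
  have hg0 : g ≠ 0 := by rintro rfl; simp at h2
  have hf0 : f ≠ 0 := by rintro rfl; simp at hf
  rw [totalDegree_mul_of_isDomain hf0 hg0, hf] at h1
  obtain ⟨m, rfl⟩ : ∃ m, k = m + 1 := ⟨k - 1, by omega⟩
  refine ⟨m, rfl, g, by omega, ?_, fun B hB hBA => ?_⟩
  · intro h; simp [h] at h2
  · have := h3 B hB.1 hBA
    rw [map_mul, mul_eq_zero] at this
    exact this.resolve_left hB.2

theorem IsSep.remove_succ {k : ℕ} {Y L : Set Pt} {A : Pt} (h : IsSep (k + 1) Y A) (hL : IsLine L)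
    (hA : A ∉ L) (hk : k + 1 < (Y ∩ L).ncard) : IsSep k (Y \ L) A := by
  obtain ⟨m, hm, h'⟩ := h.remove hL hA hk
  obtain rfl : k = m := by omega
  exact h'

theorem IsSep.ncard_le {k : ℕ} {Y L S : Set Pt} {A : Pt} (h : IsSep k Y A) (hL : IsLine L)
    (hA : A ∈ L) (hSY : S ⊆ Y) (hSL : S ⊆ L) (hSA : A ∉ S) : S.ncard ≤ k := by
  obtain ⟨q, h1, h2, h3⟩ := h
  obtain ⟨f, hf, rfl⟩ := hL
  by_contra! hk
  exact h2 (vanish_of_lt_ncard hf h1 hk (fun x hx => hSL hx) (fun x hx => h3 x (hSY hx) (by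
    rintro rfl; exact hSA hx)) A hA)

theorem IsSep.insert_line {k : ℕ} {Y L : Set Pt} {A : Pt} (h : IsSep k (Y \ L) A) (hL : IsLine L)
    (hA : A ∉ L) : IsSep (k + 1) Y A := by
  obtain ⟨q, h1, h2, h3⟩ := h
  obtain ⟨f, hf, rfl⟩ := hL
  refine ⟨f * q, (totalDegree_mul _ _).trans (by omega), ?_, fun B hB hBA => ?_⟩
  · rw [map_mul]
    exact mul_ne_zero hA h2
  · rw [map_mul, mul_eq_zero]
    by_cases hBf : eval B f = 0
    · exact Or.inl hBf
    · exact Or.inr (h3 B ⟨hB, hBf⟩ hBA)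

/-- Trading a point for another one. -/
theorem IsSep.exchange {k : ℕ} {Y : Set Pt} {A A' : Pt} (h : IsSep k Y A) (h' : IsSep k Y A')
    (hA : A ∈ Y) (hne : A ≠ A') (P : Pt) (hPA : P ≠ A) (hPA' : P ≠ A') :
    IsSep k (insert P (Y \ {A'})) A ∨ IsSep k (insert P (Y \ {A})) A' := by
  obtain ⟨q, h1, h2, h3⟩ := h
  obtain ⟨r, k1, k2, k3⟩ := h'
  by_cases hr : eval P r = 0
  · right
    refine ⟨r, k1, k2, fun B hB hBA => ?_⟩
    rcases hB with rfl | hB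
    · exact hr
    · exact k3 B hB.1 hBA
  · left
    refine ⟨C (eval P r) * q - C (eval P q) * r, ?_, ?_, fun B hB hBA => ?_⟩
    · refine (totalDegree_sub _ _).trans (max_le ?_ ?_) <;>
      refine (totalDegree_mul _ _).trans ?_ <;> simpa
    · simp [k3 A hA hne, hr, h2]
    · rcases hB with rfl | hB
      · simp [mul_comm]
      · simp [h3 B hB.1 hBA, k3 B hB.1 hB.2]

theorem IsLine.eq_of_mem {L M : Set Pt} (hL : IsLine L) (hM : IsLine M) {P Q : Pt} (hPQ : P ≠ Q)
    (hPL : P ∈ L) (hQL : Q ∈ L) (hPM : P ∈ M) (hQM : Q ∈ M) : L = M := by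
  have key : ∀ {L M : Set Pt}, IsLine L → IsLine M → P ∈ L → Q ∈ L → P ∈ M → Q ∈ M → L ⊆ M := by
    rintro L M ⟨f, hf, rfl⟩ ⟨g, hg, rfl⟩ h1 h2 h3 h4
    refine vanish_of_lt_ncard (S := {P, Q}) hf hg.le ?_ ?_ ?_
    · rw [Set.ncard_pair hPQ]; norm_num
    · rintro x (rfl | rfl) <;> assumption
    · rintro x (rfl | rfl) <;> assumption
  exact (key hL hM hPL hQL hPM hQM).antisymm (key hM hL hPM hQM hPL hQL)

theorem IsLine.eq_of_one_lt_ncard {L M S : Set Pt} (hL : IsLine L) (hM : IsLine M)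
    (hSL : S ⊆ L) (hSM : S ⊆ M) (hS : 1 < S.ncard) : L = M := by
  obtain ⟨P, hP, Q, hQ, hPQ⟩ :=
    (Set.one_lt_ncard_iff_nontrivial_and_finite.1 hS).1
  exact hL.eq_of_mem hM hPQ (hSL hP) (hSL hQ) (hSM hP) (hSM hQ)

theorem exists_isLine (P Q : Pt) (hPQ : P ≠ Q) : ∃ L, IsLine L ∧ P ∈ L ∧ Q ∈ L := by
  set f : BPoly := C (Q 1 - P 1) * X 0 + C (P 0 - Q 0) * X 1 +
    C (P 1 * Q 0 - P 0 * Q 1) with hf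
  refine ⟨{x | eval x f = 0}, ⟨f, ?_, rfl⟩, ?_, ?_⟩
  · refine le_antisymm ?_ ?_
    · have h1 (a : ℝ) (i : Fin 2) : (C a * X i : BPoly).totalDegree ≤ 1 :=
        (totalDegree_mul _ _).trans (by simp)
      exact (totalDegree_add _ _).trans (max_le ((totalDegree_add _ _).trans
        (max_le (h1 _ _) (h1 _ _))) ((totalDegree_C _).le.trans zero_le_one))
    · by_contra! h0
      have h0 : f.totalDegree = 0 := by omega
      have h1 := totalDegree_eq_zero_iff_eq_C.1 h0
      have key (x y : Pt) : eval x f = eval y f := by rw [h1]; simp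
      have e1 := key ![1, 0] ![0, 0]
      have e2 := key ![0, 1] ![0, 0]
      simp [hf] at e1 e2
      refine hPQ (funext fun i => ?_)
      fin_cases i <;> simp <;> linarith
  · simp [hf]; ring
  · simp [hf]; ring

theorem IsLine.exists_mem_notMem_finite {L S : Set Pt} (hL : IsLine L) (hS : S.Finite) :
    ∃ P ∈ L, P ∉ S := by
  have hinf : L.Infinite := by
    obtain ⟨f, hf, rfl⟩ := hL
    obtain ⟨a, b, c, rfl, hab⟩ := exists_linear_of_totalDegree_eq_one hf
    rcases hab with ha | hb
    · refine Set.infinite_of_injective_forall_mem (f := fun t : ℝ => (![-(b * t + c) / a, t] : Pt))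
        (fun s t h => by simpa using congrFun h 1) fun t => ?_
      simp
      field_simp
      ring
    · refine Set.infinite_of_injective_forall_mem (f := fun t : ℝ => (![t, -(a * t + c) / b] : Pt))
        (fun s t h => by simpa using congrFun h 0) fun t => ?_
      simp
      field_simp
      ring
  obtain ⟨P, hP, hPS⟩ := hinf.exists_notMem_finite hS
  exact ⟨P, hP, hPS⟩

theorem IsPoised.finite {n : ℕ} {X : Set Pt} (hX : IsPoised n X) : X.Finite := by
  refine Set.finite_of_ncard_pos ?_
  rw [hX.1]
  exact Nat.div_pos (by nlinarith) (by norm_num)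

theorem IsPoised.isSep {n : ℕ} {X : Set Pt} (hX : IsPoised n X) {A : Pt} (hA : A ∈ X) :
    IsSep n X A := by
  obtain ⟨p, ⟨h1, h2⟩, -⟩ := hX.2 (fun B => Set.indicator {A} 1 B)
  refine ⟨p, h1, ?_, fun B hB hBA => ?_⟩
  · rw [h2 A hA]; simp
  · rw [h2 B hB]; simp [hBA]

theorem ncard_diff_line_add {X L : Set Pt} (hX : X.Finite) :
    (X \ L).ncard + (X ∩ L).ncard = X.ncard := by
  rw [add_comm]
  exact Set.ncard_inter_add_ncard_sdiff_eq_ncard X L hX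

theorem succ_mul_div_two (m : ℕ) :
    (m + 1 + 1) * (m + 1 + 2) / 2 = (m + 1) * (m + 2) / 2 + (m + 2) := by
  rw [← Nat.add_mul_div_left _ _ (by norm_num : 0 < 2)]
  congr 1
  ring

theorem IsPoised.diff_maxLine {m : ℕ} {X L : Set Pt} (hX : IsPoised (m + 1) X)
    (hL : IsMaxLine (m + 1) X L) : IsPoised m (X \ L) := by
  classical
  obtain ⟨⟨f, hf, rfl⟩, hcard⟩ := hL
  have hf0 : f ≠ 0 := by rintro rfl; simp at hf
  have hdeg (q : BPoly) (hq : q.totalDegree ≤ m) : (f * q).totalDegree ≤ m + 1 :=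
    (totalDegree_mul _ _).trans (by omega)
  refine ⟨?_, fun c => ?_⟩
  · have h1 := ncard_diff_line_add (L := {x | eval x f = 0}) hX.finite
    have h2 := hX.1
    rw [succ_mul_div_two] at h2
    omega
  · obtain ⟨p, ⟨hp1, hp2⟩, huniq⟩ :=
      hX.2 (fun A => if eval A f = 0 then 0 else eval A f * c A)
    have hv := vanish_of_lt_ncard hf hp1 (S := X ∩ {x | eval x f = 0}) (by omega)
      (fun x hx => hx.2) (fun x hx => by
        have hx2 : eval x f = 0 := hx.2
        rw [hp2 x hx.1, if_pos hx2])
    obtain ⟨q, rfl⟩ := dvd_of_vanish hf hv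
    refine ⟨q, ⟨?_, fun A hA => ?_⟩, fun r hr => ?_⟩
    · by_cases hq : q = 0
      · simp [hq]
      · rw [totalDegree_mul_of_isDomain hf0 hq, hf] at hp1
        omega
    · have hAf : eval A f ≠ 0 := hA.2
      have := hp2 A hA.1
      rw [if_neg hAf, map_mul] at this
      exact mul_left_cancel₀ hAf this
    · refine mul_left_cancel₀ hf0 (huniq (f * r) ⟨hdeg r hr.1, fun A hA => ?_⟩)
      by_cases hAf : eval A f = 0
      · simp [hAf]
      · rw [if_neg hAf, map_mul, hr.2 A ⟨hA, hAf⟩]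

/-- A reformulation of `IsGC` with lines in place of linear factors. -/
def HasLineCovers (n : ℕ) (X : Set Pt) : Prop :=
  ∀ A ∈ X, ∃ L : Fin n → Set Pt, (∀ i, IsLine (L i) ∧ A ∉ L i) ∧
    ∀ B ∈ X, B ≠ A → ∃ i, B ∈ L i

theorem IsGC.hasLineCovers {n : ℕ} {X : Set Pt} (hX : IsGC n X) : HasLineCovers n X := by
  intro A hA
  obtain ⟨p, ⟨-, h2, h3⟩, f, hf, rfl⟩ := hX.2 A hA
  rw [map_prod] at h2
  refine ⟨fun i => {x | eval x (f i) = 0}, fun i => ⟨⟨f i, hf i, rfl⟩, fun hi => ?_⟩,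
    fun B hB hBA => ?_⟩
  · have hi : eval A (f i) = 0 := hi
    rw [Finset.prod_eq_zero (Finset.mem_univ i) hi] at h2
    exact zero_ne_one h2
  · have := h3 B hB hBA
    rw [map_prod, Finset.prod_eq_zero_iff] at this
    obtain ⟨i, -, hi⟩ := this
    exact ⟨i, hi⟩

theorem HasLineCovers.isGC {m : ℕ} {X : Set Pt} (h : HasLineCovers (m + 1) X)
    (hX : IsPoised (m + 1) X) : IsGC (m + 1) X := by
  refine ⟨hX, fun A hA => ?_⟩
  obtain ⟨L, hL, hcov⟩ := h A hA
  choose f hf using fun i => (hL i).1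
  have hAf (i) : eval A (f i) ≠ 0 := fun h0 => (hL i).2 (by rw [(hf i).2]; exact h0)
  set g : Fin (m + 1) → BPoly := fun i => C (eval A (f i))⁻¹ * f i with hg
  have hgdeg (i) : (g i).totalDegree = 1 := by
    have hC : (C (eval A (f i))⁻¹ : BPoly) ≠ 0 := by simpa using hAf i
    rw [hg, totalDegree_mul_of_isDomain hC (by rintro h0; simpa [h0] using (hf i).1),
      totalDegree_C, (hf i).1]
  refine ⟨∏ i, g i, ⟨?_, ?_, fun B hB hBA => ?_⟩, g, hgdeg, rfl⟩
  · refine (totalDegree_finsetProd _ _).trans ?_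
    simp [hgdeg]
  · rw [map_prod]
    exact Finset.prod_eq_one fun i _ => by simp [hg, hAf i]
  · obtain ⟨i, hi⟩ := hcov B hB hBA
    rw [map_prod, Finset.prod_eq_zero (Finset.mem_univ i)]
    have : eval B (f i) = 0 := by rw [(hf i).2] at hi; exact hi
    simp [hg, this]

theorem HasLineCovers.diff_maxLine {m : ℕ} {X M : Set Pt} (h : HasLineCovers (m + 1) X)
    (hM : IsMaxLine (m + 1) X M) : HasLineCovers m (X \ M) := by
  intro A hA
  obtain ⟨L, hL, hcov⟩ := h A hA.1
  have : ∃ i, L i = M := by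
    have hfin : (X ∩ M).Finite := Set.finite_of_ncard_pos (by rw [hM.2]; omega)
    have hmem : ∀ B : Pt, B ∈ X ∩ M → ∃ i, B ∈ L i := fun B hB =>
      hcov B hB.1 (by rintro rfl; exact hA.2 hB.2)
    choose! φ hφ using hmem
    obtain ⟨P, hP, Q, hQ, hPQ, hPQφ⟩ :=
      Set.exists_ne_map_eq_of_ncard_lt_of_maps_to (s := X ∩ M) (t := (Set.univ : Set (Fin (m + 1))))
        (by rw [hM.2, Set.ncard_univ, Nat.card_fin]; omega) (f := φ) (fun _ _ => Set.mem_univ _)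
    exact ⟨φ P, (hL _).1.eq_of_mem hM.1 hPQ (hφ P hP) (hPQφ ▸ hφ Q hQ) hP.2 hQ.2⟩
  obtain ⟨i, rfl⟩ := this
  refine ⟨fun j => L (i.succAbove j), fun j => hL _, fun B hB hBA => ?_⟩
  obtain ⟨j, hj⟩ := hcov B hB.1 hBA
  rcases Fin.eq_self_or_eq_succAbove i j with rfl | ⟨k, rfl⟩
  · exact absurd hj hB.2
  · exact ⟨k, hj⟩

/-- `GC_n` sets with lines in place of linear factors. -/
def LineGC (n : ℕ) (X : Set Pt) : Prop := IsPoised n X ∧ HasLineCovers n X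

theorem LineGC.diff_maxLine {m : ℕ} {X M : Set Pt} (h : LineGC (m + 1) X)
    (hM : IsMaxLine (m + 1) X M) : LineGC m (X \ M) :=
  ⟨h.1.diff_maxLine hM, h.2.diff_maxLine hM⟩

/-- Every node `V ≠ A` lies on some line used by `A`. -/
theorem LineGC.exists_line {m : ℕ} {X : Set Pt} (h : LineGC (m + 1) X) {A V : Pt} (hA : A ∈ X)
    (hV : V ∈ X) (hVA : V ≠ A) : ∃ L, IsLine L ∧ V ∈ L ∧ A ∉ L ∧ IsSep m (X \ L) A := by
  obtain ⟨L, hL, hcov⟩ := h.2 A hA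
  obtain ⟨i, hi⟩ := hcov V hV hVA
  choose f hf using fun i => (hL i).1
  have hmem (i) (x) : x ∈ L i ↔ eval x (f i) = 0 := by rw [(hf i).2]; rfl
  refine ⟨L i, (hL i).1, hi, (hL i).2, ∏ j : Fin m, f (i.succAbove j), ?_, ?_, fun B hB hBA => ?_⟩
  · refine (totalDegree_finsetProd _ _).trans ?_
    simp [(hf _).1]
  · rw [map_prod, Finset.prod_ne_zero_iff]
    exact fun j _ h0 => (hL _).2 ((hmem _ _).2 h0)
  · obtain ⟨j, hj⟩ := hcov B hB.1 hBA
    rcases Fin.eq_self_or_eq_succAbove i j with rfl | ⟨k, rfl⟩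
    · exact absurd hj hB.2
    · rw [map_prod, Finset.prod_eq_zero (Finset.mem_univ k)]
      exact (hmem _ _).1 hj

theorem IsPoised.ncard_inter_line_le {n : ℕ} {X L : Set Pt} (hX : IsPoised n X) (hL : IsLine L) :
    (X ∩ L).ncard ≤ n + 1 := by
  by_contra! h
  obtain ⟨A, hA⟩ := Set.nonempty_of_ncard_ne_zero (s := X ∩ L) (by omega)
  have h1 := (hX.isSep hA.1).ncard_le hL hA.2 (S := (X ∩ L) \ {A}) (fun x hx => hx.1.1)
    (fun x hx => hx.1.2) (by simp)
  have h2 := Set.pred_ncard_le_ncard_sdiff_singleton (X ∩ L) A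
  omega

theorem ncard_diff_inter_of_hit {X L M : Set Pt} (hX : X.Finite) (hL : IsLine L) (hM : IsLine M)
    (hne : L ≠ M) {D : Pt} (hDX : D ∈ X) (hDL : D ∈ L) (hDM : D ∈ M) :
    ((X \ M) ∩ L).ncard + 1 = (X ∩ L).ncard := by
  have : (X \ M) ∩ L = (X ∩ L) \ {D} := by
    ext x
    constructor
    · rintro ⟨⟨h1, h2⟩, h3⟩
      exact ⟨⟨h1, h3⟩, fun h => h2 (h ▸ hDM)⟩
    · rintro ⟨⟨h1, h2⟩, h3⟩
      exact ⟨⟨h1, fun h => hne (hL.eq_of_mem hM h3 h2 hDL h hDM)⟩, h2⟩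
  rw [this]
  exact Set.ncard_sdiff_singleton_add_one ⟨hDX, hDL⟩ (hX.inter_of_left L)

theorem diff_inter_of_miss {X L M : Set Pt} (h : ∀ D ∈ X, D ∈ L → D ∉ M) :
    (X \ M) ∩ L = X ∩ L := by
  ext x
  constructor
  · rintro ⟨⟨h1, h2⟩, h3⟩
    exact ⟨h1, h3⟩
  · rintro ⟨h1, h2⟩
    exact ⟨⟨h1, h x h1 h2⟩, h2⟩

theorem IsMaxLine.meet {m : ℕ} {X L M : Set Pt} (hX : IsPoised (m + 1) X)
    (hL : IsMaxLine (m + 1) X L) (hM : IsMaxLine (m + 1) X M) :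
    ∃ D ∈ X, D ∈ L ∧ D ∈ M := by
  by_contra! h
  have h1 := (hX.diff_maxLine hM).ncard_inter_line_le hL.1
  rw [diff_inter_of_miss h, hL.2] at h1
  omega

theorem IsMaxLine.diff {m : ℕ} {X L M : Set Pt} (hX : IsPoised (m + 1) X)
    (hL : IsMaxLine (m + 1) X L) (hM : IsMaxLine (m + 1) X M) (hne : L ≠ M) :
    IsMaxLine m (X \ M) L := by
  obtain ⟨D, hD, hDL, hDM⟩ := hL.meet hX hM
  have := ncard_diff_inter_of_hit hX.finite hL.1 hM.1 hne hD hDL hDM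
  rw [hL.2] at this
  exact ⟨hL.1, by omega⟩

theorem IsMaxLine.ne_of_diff {m : ℕ} {X L M : Set Pt} (hL : IsMaxLine m (X \ M) L) : L ≠ M := by
  rintro rfl
  have := hL.2
  simp at this

theorem IsMaxLine.of_diff {m : ℕ} {X L M : Set Pt} (hX : X.Finite) (hM : IsLine M)
    (hL : IsMaxLine m (X \ M) L) {D : Pt} (hDX : D ∈ X) (hDL : D ∈ L) (hDM : D ∈ M) :
    IsMaxLine (m + 1) X L := by
  refine ⟨hL.1, ?_⟩
  rw [← ncard_diff_inter_of_hit hX hL.1 hM hL.ne_of_diff hDX hDL hDM, hL.2]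

theorem IsMaxLine.not_concurrent {m : ℕ} {X L₁ L₂ L₃ : Set Pt} (hX : IsPoised (m + 1) X)
    (h1 : IsMaxLine (m + 1) X L₁) (h2 : IsMaxLine (m + 1) X L₂) (h3 : IsMaxLine (m + 1) X L₃)
    (h12 : L₁ ≠ L₂) (h13 : L₁ ≠ L₃) (h23 : L₂ ≠ L₃) {V : Pt} (hV1 : V ∈ L₁) (hV2 : V ∈ L₂) :
    V ∉ L₃ := by
  intro hV3
  have hS := Set.pred_ncard_le_ncard_sdiff_singleton (X ∩ L₃) V
  rw [h3.2] at hS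
  obtain ⟨A, ⟨hA, hA3⟩, hAV⟩ := Set.nonempty_of_ncard_ne_zero (s := (X ∩ L₃) \ {V}) (by omega)
  have hAV : A ≠ V := hAV
  have hA1 : A ∉ L₁ := fun h => h13 (h1.1.eq_of_mem h3.1 hAV h hV1 hA3 hV3)
  have hA2 : A ∉ L₂ := fun h => h23 (h2.1.eq_of_mem h3.1 hAV h hV2 hA3 hV3)
  have s1 := (hX.isSep hA).remove_succ h1.1 hA1 (by rw [h1.2]; omega)
  obtain ⟨k, rfl, s2⟩ := s1.remove h2.1 hA2 (by rw [(h2.diff hX h1 h12.symm).2]; omega)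
  have s3 := s2.ncard_le h3.1 hA3 (S := ((X ∩ L₃) \ {V}) \ {A}) ?_ (fun x hx => hx.1.1.2) (by simp)
  · have := Set.pred_ncard_le_ncard_sdiff_singleton ((X ∩ L₃) \ {V}) A
    omega
  · rintro x ⟨⟨⟨hx, hx3⟩, hxV⟩, -⟩
    exact ⟨⟨hx, fun h => h13 (h1.1.eq_of_mem h3.1 hxV h hV1 hx3 hV3)⟩,
      fun h => h23 (h2.1.eq_of_mem h3.1 hxV h hV2 hx3 hV3)⟩

/-- A line used by a node of a maximal line meets the maximal line in a node. -/
theorem IsSep.hit {m : ℕ} {X L M : Set Pt} {A : Pt} (h : IsSep m (X \ L) A)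
    (hM : IsMaxLine (m + 1) X M) (hA : A ∈ M) : ∃ D ∈ X, D ∈ M ∧ D ∈ L := by
  by_contra! hmiss
  have h1 := h.ncard_le hM.1 hA (S := (X ∩ M) \ {A})
    (fun x hx => ⟨hx.1.1, hmiss x hx.1.1 hx.1.2⟩) (fun x hx => hx.1.2) (by simp)
  have h2 := Set.pred_ncard_le_ncard_sdiff_singleton (X ∩ M) A
  rw [hM.2] at h2
  omega

theorem LineGC.hit_of_two_miss {m : ℕ} {X M N₁ N₂ N₃ : Set Pt} (hX : LineGC (m + 2) X)
    (hM : IsMaxLine (m + 2) X M) (h1 : IsMaxLine (m + 1) (X \ M) N₁)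
    (h2 : IsMaxLine (m + 1) (X \ M) N₂) (h3 : IsMaxLine (m + 1) (X \ M) N₃)
    (h12 : N₁ ≠ N₂) (h13 : N₁ ≠ N₃) (h23 : N₂ ≠ N₃) (hm1 : ∀ D ∈ X, D ∈ N₁ → D ∉ M) :
    ∃ D ∈ X, D ∈ N₂ ∧ D ∈ M := by
  by_contra! hm2
  have hZ : IsPoised (m + 1) (X \ M) := hX.1.diff_maxLine hM
  have hfin := hX.1.finite
  have c1 : (X ∩ N₁).ncard = m + 2 := by rw [← diff_inter_of_miss hm1, h1.2]
  have c2 : (X ∩ N₂).ncard = m + 2 := by rw [← diff_inter_of_miss hm2, h2.2]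
  obtain ⟨V, ⟨hVX, hVM⟩, hV1, hV2⟩ := h1.meet hZ h2
  have hV3 : V ∉ N₃ := h1.not_concurrent hZ h2 h3 h12 h13 h23 hV1 hV2
  have hl : ∀ A ∈ X ∩ M, ∃ l, IsLine l ∧ V ∈ l ∧ A ∉ l ∧ IsSep (m + 1) (X \ l) A := fun A hA =>
    hX.exists_line hA.1 hVX (by rintro rfl; exact hVM hA.2)
  choose! l hlL hlV hlA hlS using hl
  have hl1 (A) (hA : A ∈ X ∩ M) : l A ≠ N₁ := by
    intro h
    obtain ⟨D, hD, hDM, hDl⟩ := (hlS A hA).hit hM hA.2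
    exact hm1 D hD (h ▸ hDl) hDM
  have hl2 (A) (hA : A ∈ X ∩ M) : l A ≠ N₂ := by
    intro h
    obtain ⟨D, hD, hDM, hDl⟩ := (hlS A hA).hit hM hA.2
    exact hm2 D hD (h ▸ hDl) hDM
  obtain ⟨P, hP1, hPX⟩ := h1.1.exists_mem_notMem_finite hfin
  have aux (A A') (hA : A ∈ X ∩ M) (hA' : A' ∈ X ∩ M) (hll : l A = l A')
      (hs : IsSep (m + 1) (insert P ((X \ l A) \ {A'})) A) : False := by
    have hAM : A ∉ N₁ := fun h => hm1 A hA.1 h hA.2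
    have hAM2 : A ∉ N₂ := fun h => hm2 A hA.1 h hA.2
    have s1 := hs.remove_succ h1.1 hAM (by
      have e1 : insert P ((X ∩ N₁) \ {V}) ⊆ insert P ((X \ l A) \ {A'}) ∩ N₁ := by
        rintro x (rfl | ⟨⟨hx, hx1⟩, hxV⟩)
        · exact ⟨Or.inl rfl, hP1⟩
        · refine ⟨Or.inr ⟨⟨hx, fun hxl => hl1 A hA ?_⟩, ?_⟩, hx1⟩
          · exact (hlL A hA).eq_of_mem h1.1 hxV hxl (hlV A hA) hx1 hV1
          · rintro rfl
            exact hm1 _ hx hx1 hA'.2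
      have e2 := Set.ncard_le_ncard e1
        (((hfin.sdiff.sdiff).insert P).inter_of_left N₁)
      rw [Set.ncard_insert_of_notMem (fun h => hPX h.1.1)
        ((hfin.inter_of_left N₁).sdiff)] at e2
      have e3 := Set.pred_ncard_le_ncard_sdiff_singleton (X ∩ N₁) V
      omega)
    obtain ⟨k, rfl, s2⟩ := s1.remove h2.1 hAM2 (by
      have e1 : (X ∩ N₂) \ {V} ⊆ (insert P ((X \ l A) \ {A'}) \ N₁) ∩ N₂ := by
        rintro x ⟨⟨hx, hx1⟩, hxV⟩
        refine ⟨⟨Or.inr ⟨⟨hx, fun hxl => hl2 A hA ?_⟩, ?_⟩, fun hx' => h12 ?_⟩, hx1⟩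
        · exact (hlL A hA).eq_of_mem h2.1 hxV hxl (hlV A hA) hx1 hV2
        · rintro rfl
          exact hm2 _ hx hx1 hA'.2
        · exact h1.1.eq_of_mem h2.1 hxV hx' hV1 hx1 hV2
      have e2 := Set.ncard_le_ncard e1
        ((((hfin.sdiff.sdiff).insert P).sdiff).inter_of_left N₂)
      have e3 := Set.pred_ncard_le_ncard_sdiff_singleton (X ∩ N₂) V
      omega)
    obtain ⟨D, hD, hDM, hDl⟩ := (hlS A hA).hit hM hA.2
    have s3 := s2.ncard_le hM.1 hA.2 (S := (((X ∩ M) \ {A}) \ {A'}) \ {D}) (by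
        rintro x ⟨⟨⟨⟨hx, hxM⟩, hxA⟩, hxA'⟩, hxD⟩
        refine ⟨⟨Or.inr ⟨⟨hx, fun hxl => ?_⟩, hxA'⟩, fun h => hm1 x hx h hxM⟩,
          fun h => hm2 x hx h hxM⟩
        have := (hlL A hA).eq_of_mem hM.1 hxD hxl hDl hxM hDM
        exact hlA A hA (this ▸ hA.2))
      (fun x hx => hx.1.1.1.2) (by simp)
    have e1 := Set.pred_ncard_le_ncard_sdiff_singleton (X ∩ M) A
    have e2 := Set.pred_ncard_le_ncard_sdiff_singleton ((X ∩ M) \ {A}) A'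
    have e3 := Set.pred_ncard_le_ncard_sdiff_singleton (((X ∩ M) \ {A}) \ {A'}) D
    rw [hM.2] at e1
    omega
  have hinj (A A') (hA : A ∈ X ∩ M) (hA' : A' ∈ X ∩ M) (hll : l A = l A') : A = A' := by
    by_contra hne
    have hs' := hlS A' hA'
    rw [← hll] at hs'
    rcases (hlS A hA).exchange hs' ⟨hA.1, hlA A hA⟩ hne P (by rintro rfl; exact hPX hA.1)
      (by rintro rfl; exact hPX hA'.1) with h | h
    · exact aux A A' hA hA' hll h
    · exact aux A' A hA' hA hll.symm (hll ▸ h)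
  by_cases hm3 : ∀ D ∈ X, D ∈ N₃ → D ∉ M
  · have c3 : (X ∩ N₃).ncard = m + 2 := by rw [← diff_inter_of_miss hm3, h3.2]
    have hφ : ∀ A ∈ X ∩ M, ∃ E ∈ X ∩ N₃, E ∈ l A := by
      intro A hA
      by_contra! hno
      have s1 := (hlS A hA).remove_succ h3.1 (fun h => hm3 A hA.1 h hA.2) (by
        rw [diff_inter_of_miss fun D hD hD3 => hno D ⟨hD, hD3⟩, c3]
        omega)
      obtain ⟨D, hD, hDM, hDl⟩ := (hlS A hA).hit hM hA.2
      have s2 := s1.ncard_le hM.1 hA.2 (S := ((X ∩ M) \ {A}) \ {D}) (by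
        rintro x ⟨⟨⟨hx, hxM⟩, hxA⟩, hxD⟩
        refine ⟨⟨hx, fun hxl => ?_⟩, fun h => hm3 x hx h hxM⟩
        have := (hlL A hA).eq_of_mem hM.1 hxD hxl hDl hxM hDM
        exact hlA A hA (this ▸ hA.2))
        (fun x hx => hx.1.1.2) (by simp)
      have e1 := Set.pred_ncard_le_ncard_sdiff_singleton (X ∩ M) A
      have e2 := Set.pred_ncard_le_ncard_sdiff_singleton ((X ∩ M) \ {A}) D
      rw [hM.2] at e1
      omega
    choose! φ hφ3 hφl using hφ
    obtain ⟨A, hA, A', hA', hne, heq⟩ := Set.exists_ne_map_eq_of_ncard_lt_of_maps_to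
      (s := X ∩ M) (t := X ∩ N₃) (by rw [hM.2, c3]; omega) hφ3 (hfin.inter_of_left _)
    refine hne (hinj A A' hA hA' ((hlL A hA).eq_of_mem (hlL A' hA') (P := V) (Q := φ A) ?_
      (hlV A hA) (hφl A hA) (hlV A' hA') (heq ▸ hφl A' hA')))
    rintro h
    exact hV3 (h ▸ (hφ3 A hA).2)
  · push Not at hm3
    obtain ⟨D, hD, hD3, hDM⟩ := hm3
    have h3X := h3.of_diff hfin hM.1 hD hD3 hDM
    have hφ : ∀ A ∈ X ∩ M, ∃ E ∈ X ∩ M, E ∈ l A := fun A hA => by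
      obtain ⟨E, h1, h2, h3⟩ := (hlS A hA).hit hM hA.2
      exact ⟨E, ⟨h1, h2⟩, h3⟩
    choose! φ hφM hφl using hφ
    have hφinj : Set.InjOn φ (X ∩ M) := by
      intro A hA A' hA' heq
      refine hinj A A' hA hA' ((hlL A hA).eq_of_mem (hlL A' hA') (P := V) (Q := φ A) ?_
        (hlV A hA) (hφl A hA) (hlV A' hA') (heq ▸ hφl A' hA'))
      rintro h
      exact hVM (h ▸ (hφM A hA).2)
    have himg : φ '' (X ∩ M) = X ∩ M :=
      Set.eq_of_subset_of_ncard_le (Set.image_subset_iff.2 hφM) (by rw [hφinj.ncard_image])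
        (hfin.inter_of_left M)
    obtain ⟨A, hA, hAD⟩ : D ∈ φ '' (X ∩ M) := himg.symm ▸ ⟨hD, hDM⟩
    have hDl : D ∈ l A := hAD ▸ hφl A hA
    have hADne : A ≠ D := by rintro rfl; exact hlA A hA hDl
    have hA3 : A ∉ N₃ := fun h => h3.ne_of_diff (h3.1.eq_of_mem hM.1 hADne h hD3 hA.2 hDM)
    have s1 := (hlS A hA).remove_succ h3.1 hA3 (by
      have := ncard_diff_inter_of_hit hfin h3.1 (hlL A hA)
        (fun h => hV3 (by rw [h]; exact hlV A hA)) hD hD3 hDl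
      rw [h3X.2] at this
      omega)
    have s2 := s1.ncard_le hM.1 hA.2 (S := ((X ∩ M) \ {A}) \ {D}) (by
        rintro x ⟨⟨⟨hx, hxM⟩, hxA⟩, hxD⟩
        refine ⟨⟨hx, fun hxl => ?_⟩, fun h => h3.ne_of_diff ?_⟩
        · have := (hlL A hA).eq_of_mem hM.1 hxD hxl hDl hxM hDM
          exact hlA A hA (this ▸ hA.2)
        · exact h3.1.eq_of_mem hM.1 hxD h hD3 hxM hDM)
        (fun x hx => hx.1.1.2) (by simp)
    have e1 := Set.pred_ncard_le_ncard_sdiff_singleton (X ∩ M) A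
    have e2 := Set.pred_ncard_le_ncard_sdiff_singleton ((X ∩ M) \ {A}) D
    rw [hM.2] at e1
    omega

/-- The Gasca–Maeztu conjecture up to degree `n`, in terms of `LineGC`. -/
def GMUpTo (n : ℕ) : Prop :=
  ∀ k, 1 ≤ k → k ≤ n → ∀ Y, LineGC k Y → ∃ M, IsMaxLine k Y M

theorem GMUpTo.mono {n k : ℕ} (h : GMUpTo n) (hk : k ≤ n) : GMUpTo k :=
  fun j h1 h2 => h j h1 (h2.trans hk)

theorem LineGC.exists_maxLine_one {X : Set Pt} (hX : LineGC 1 X) {A : Pt} (hA : A ∈ X) :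
    ∃ L, IsMaxLine 1 X L ∧ A ∉ L := by
  obtain ⟨L, hL, hcov⟩ := hX.2 A hA
  have h3 : X.ncard = 3 := hX.1.1
  refine ⟨L 0, ⟨(hL 0).1, ?_⟩, (hL 0).2⟩
  have : X ∩ L 0 = X \ {A} := by
    ext x
    simp only [Set.mem_inter_iff, Set.mem_sdiff, Set.mem_singleton_iff, and_congr_right_iff]
    intro hx
    refine ⟨fun h => by rintro rfl; exact (hL 0).2 h, fun h => ?_⟩
    obtain ⟨i, hi⟩ := hcov x hx h
    rwa [Subsingleton.elim i 0] at hi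
  rw [this, Set.ncard_sdiff_singleton_of_mem hA, h3]

theorem LineGC.three_maxLines {m : ℕ} {X : Set Pt} (hG : GMUpTo (m + 1)) (hX : LineGC (m + 1) X) :
    ∃ L₁ L₂ L₃, IsMaxLine (m + 1) X L₁ ∧ IsMaxLine (m + 1) X L₂ ∧ IsMaxLine (m + 1) X L₃ ∧
      L₁ ≠ L₂ ∧ L₁ ≠ L₃ ∧ L₂ ≠ L₃ := by
  induction m generalizing X with
  | zero =>
    have hc : X.ncard = 3 := hX.1.1
    obtain ⟨A, B, C, hAB, hAC, hBC, rfl⟩ := Set.ncard_eq_three.1 hc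
    obtain ⟨L₁, h1, h1'⟩ := hX.exists_maxLine_one (A := A) (by simp)
    obtain ⟨L₂, h2, h2'⟩ := hX.exists_maxLine_one (A := B) (by simp)
    obtain ⟨L₃, h3, h3'⟩ := hX.exists_maxLine_one (A := C) (by simp)
    have key : ∀ {P Q L}, IsMaxLine 1 {A, B, C} L → P ∈ ({A, B, C} : Set Pt) →
        Q ∈ ({A, B, C} : Set Pt) → P ≠ Q → P ∉ L → Q ∈ L := by
      intro P Q L hL hP hQ hPQ hPL
      by_contra hQL
      have hsub : ({A, B, C} : Set Pt) ∩ L ⊆ ({A, B, C} \ {P}) \ {Q} := by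
        rintro x ⟨hx, hxL⟩
        exact ⟨⟨hx, by rintro rfl; exact hPL hxL⟩, by rintro rfl; exact hQL hxL⟩
      have := Set.ncard_le_ncard hsub ((hX.1.finite.sdiff).sdiff)
      rw [Set.ncard_sdiff_singleton_of_mem (s := {A, B, C} \ {P}) (a := Q)
          ⟨hQ, fun h => hPQ h.symm⟩,
        Set.ncard_sdiff_singleton_of_mem hP, hc, hL.2] at this
      omega
    refine ⟨L₁, L₂, L₃, h1, h2, h3, ?_, ?_, ?_⟩
    · rintro rfl
      exact h2' (key h1 (by simp) (by simp) hAB h1')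
    · rintro rfl
      exact h3' (key h1 (by simp) (by simp) hAC h1')
    · rintro rfl
      exact h3' (key h2 (by simp) (by simp) hBC h2')
  | succ m ih =>
    obtain ⟨M, hM⟩ := hG (m + 2) (by omega) le_rfl X hX
    obtain ⟨N₁, N₂, N₃, h1, h2, h3, h12, h13, h23⟩ :=
      ih (hG.mono (Nat.le_succ _)) (hX.diff_maxLine hM)
    have hfin := hX.1.finite
    have key : ∀ {N : Set Pt}, IsMaxLine (m + 1) (X \ M) N → (∃ D ∈ X, D ∈ N ∧ D ∈ M) →
        IsMaxLine (m + 2) X N := fun hN ⟨D, hD, hDN, hDM⟩ => hN.of_diff hfin hM.1 hD hDN hDM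
    by_cases k1 : ∃ D ∈ X, D ∈ N₁ ∧ D ∈ M
    · by_cases k2 : ∃ D ∈ X, D ∈ N₂ ∧ D ∈ M
      · exact ⟨M, N₁, N₂, hM, key h1 k1, key h2 k2, h1.ne_of_diff.symm, h2.ne_of_diff.symm, h12⟩
      · have k3 := hX.hit_of_two_miss hM h2 h3 h1 h23 h12.symm h13.symm (by
          push Not at k2; exact k2)
        exact ⟨M, N₁, N₃, hM, key h1 k1, key h3 k3, h1.ne_of_diff.symm, h3.ne_of_diff.symm, h13⟩
    · push Not at k1
      have k2 := hX.hit_of_two_miss hM h1 h2 h3 h12 h13 h23 k1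
      have k3 := hX.hit_of_two_miss hM h1 h3 h2 h13 h12 h23.symm k1
      exact ⟨M, N₂, N₃, hM, key h2 k2, key h3 k3, h2.ne_of_diff.symm, h3.ne_of_diff.symm, h23⟩

theorem uses_iff_isSep {m : ℕ} {X ℓ : Set Pt} {A : Pt} (hℓ : IsLine ℓ) :
    Uses (m + 1) X ℓ A ↔ A ∉ ℓ ∧ IsSep m (X \ ℓ) A := by
  constructor
  · rintro ⟨p, f, ⟨hp, hpA, hpB⟩, hf, rfl, g, rfl⟩
    have hf0 : f ≠ 0 := by rintro rfl; simp at hf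
    have hg0 : g ≠ 0 := by rintro rfl; simp at hpA
    rw [totalDegree_mul_of_isDomain hf0 hg0] at hp
    rw [eval_mul] at hpA
    refine ⟨fun h => ?_, g, by omega, right_ne_zero_of_mul (hpA.trans_ne one_ne_zero), ?_⟩
    · have h : eval A f = 0 := h
      simp [h] at hpA
    · rintro B ⟨hB, hBf⟩ hBA
      have := hpB B hB hBA
      rw [eval_mul] at this
      exact (mul_eq_zero.1 this).resolve_left hBf
  · rintro ⟨hA, q, hq, hqA, hqB⟩
    obtain ⟨f, hf, rfl⟩ := hℓ
    have hA : eval A f ≠ 0 := hA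
    refine ⟨f * (C (eval A f * eval A q)⁻¹ * q), f, ⟨?_, ?_, fun B hB hBA => ?_⟩, hf, rfl,
      dvd_mul_right _ _⟩
    · refine (totalDegree_mul _ _).trans ?_
      have := totalDegree_mul (C (eval A f * eval A q)⁻¹) q
      rw [totalDegree_C] at this
      omega
    · simp only [eval_mul, eval_C]
      field_simp
    · by_cases h : eval B f = 0
      · simp [h]
      · simp [hqB B ⟨hB, h⟩ hBA]

/-- A maximal line `L` that meets `ℓ` in no node of `X`. -/
def IsDisjointMax (n : ℕ) (X ℓ L : Set Pt) : Prop :=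
  IsMaxLine n X L ∧ ∀ D ∈ X, D ∈ L → D ∉ ℓ

/-- Two distinct maximal lines that meet at a node of `X` on `ℓ`. -/
def IsMaxPair (n : ℕ) (X ℓ L L' : Set Pt) : Prop :=
  IsMaxLine n X L ∧ IsMaxLine n X L' ∧ L ≠ L' ∧ ∃ B ∈ X, B ∈ ℓ ∧ B ∈ L ∧ B ∈ L'

theorem IsMaxPair.symm {n : ℕ} {X ℓ L L' : Set Pt} (h : IsMaxPair n X ℓ L L') :
    IsMaxPair n X ℓ L' L := by
  obtain ⟨h1, h2, h3, B, h4, h5, h6, h7⟩ := h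
  exact ⟨h2, h1, h3.symm, B, h4, h5, h7, h6⟩

theorem IsNodeLine.ne_maxLine {n : ℕ} {X ℓ L : Set Pt} (hℓ : IsNodeLine n X ℓ)
    (hL : IsMaxLine n X L) : ℓ ≠ L := by
  rintro rfl
  have h1 := hℓ.2
  have h2 := hL.2
  omega

theorem IsDisjointMax.isSep_iff {m : ℕ} {X ℓ L : Set Pt} (hX : IsPoised (m + 1) X)
    (hℓ : IsNodeLine (m + 1) X ℓ) (h : IsDisjointMax (m + 1) X ℓ L) {A : Pt} (hA : A ∈ X)
    (hAℓ : A ∉ ℓ) : IsSep m (X \ ℓ) A ↔ A ∉ L := by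
  obtain ⟨hL, hd⟩ := h
  constructor
  · intro hs hAL
    obtain ⟨D, h1, h2, h3⟩ := hs.hit hL hAL
    exact hd D h1 h2 h3
  · intro hAL
    have s1 := (hX.isSep hA).remove_succ hL.1 hAL (by rw [hL.2]; omega)
    obtain ⟨k, rfl, s2⟩ := s1.remove hℓ.1 hAℓ (by
      rw [diff_inter_of_miss (fun D h1 h2 h3 => hd D h1 h3 h2), hℓ.2]; omega)
    rw [sdiff_sdiff_comm] at s2
    exact s2.insert_line hL.1 hAL

theorem ncard_diff_diff_inter {X ℓ L L' : Set Pt} (hX : X.Finite) (hℓ : IsLine ℓ)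
    (hL : IsLine L) (hL' : IsLine L') (h1 : ℓ ≠ L) (h2 : ℓ ≠ L') {B : Pt}
    (hB : B ∈ X) (hBℓ : B ∈ ℓ) (hBL : B ∈ L) (hBL' : B ∈ L') :
    (((X \ L) \ L') ∩ ℓ).ncard + 1 = (X ∩ ℓ).ncard := by
  rw [← ncard_diff_inter_of_hit hX hℓ hL h1 hB hBℓ hBL, diff_inter_of_miss]
  rintro D ⟨hD, hDL⟩ hDℓ hDL'
  exact h2 (hℓ.eq_of_mem hL' (P := D) (Q := B) (by rintro rfl; exact hDL hBL) hDℓ hBℓ hDL' hBL')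

theorem IsMaxPair.notMem_of_isSep {m : ℕ} {X ℓ L L' : Set Pt} (hX : IsPoised (m + 1) X)
    (hℓ : IsNodeLine (m + 1) X ℓ) (h : IsMaxPair (m + 1) X ℓ L L') {A : Pt}
    (hAℓ : A ∉ ℓ) (hs : IsSep m (X \ ℓ) A) : A ∉ L := by
  obtain ⟨hL, hL', hne, B, hB, hBℓ, hBL, hBL'⟩ := h
  intro hAL
  have hAB : A ≠ B := by rintro rfl; exact hAℓ hBℓ
  have hℓL := hℓ.ne_maxLine hL
  have hAL' : A ∉ L' := fun h => hne (hL.1.eq_of_mem hL'.1 hAB hAL hBL h hBL')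
  have hc := ncard_diff_inter_of_hit hX.finite hL'.1 hℓ.1 (hℓ.ne_maxLine hL').symm hB hBL' hBℓ
  rw [hL'.2] at hc
  obtain ⟨k, rfl, s⟩ := hs.remove hL'.1 hAL' (by omega)
  have h1 := s.ncard_le hL.1 hAL (S := ((X ∩ L) \ {B}) \ {A}) (by
    rintro x ⟨⟨⟨hx, hxL⟩, hxB⟩, -⟩
    exact ⟨⟨hx, fun h => hℓL (hℓ.1.eq_of_mem hL.1 hxB h hBℓ hxL hBL)⟩,
      fun h => hne (hL.1.eq_of_mem hL'.1 hxB hxL hBL h hBL')⟩) (fun x hx => hx.1.1.2) (by simp)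
  have h2 := Set.pred_ncard_le_ncard_sdiff_singleton ((X ∩ L) \ {B}) A
  have h3 := Set.pred_ncard_le_ncard_sdiff_singleton (X ∩ L) B
  have h4 := hL.2
  omega

theorem IsMaxPair.isSep_iff {m : ℕ} {X ℓ L L' : Set Pt} (hX : IsPoised (m + 1) X)
    (hℓ : IsNodeLine (m + 1) X ℓ) (h : IsMaxPair (m + 1) X ℓ L L') {A : Pt} (hA : A ∈ X)
    (hAℓ : A ∉ ℓ) : IsSep m (X \ ℓ) A ↔ A ∉ L ∧ A ∉ L' := by
  refine ⟨fun hs => ⟨h.notMem_of_isSep hX hℓ hAℓ hs, h.symm.notMem_of_isSep hX hℓ hAℓ hs⟩, ?_⟩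
  obtain ⟨hL, hL', hne, B, hB, hBℓ, hBL, hBL'⟩ := h
  rintro ⟨hAL, hAL'⟩
  have s1 := (hX.isSep hA).remove_succ hL.1 hAL (by rw [hL.2]; omega)
  obtain ⟨k, rfl, s2⟩ := s1.remove hL'.1 hAL' (by
    rw [(hL'.diff hX hL hne.symm).2]; omega)
  have hc := ncard_diff_diff_inter hX.finite hℓ.1 hL.1 hL'.1 (hℓ.ne_maxLine hL)
    (hℓ.ne_maxLine hL') hB hBℓ hBL hBL'
  rw [hℓ.2] at hc
  obtain ⟨j, rfl, s3⟩ := s2.remove hℓ.1 hAℓ (by omega)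
  rw [sdiff_sdiff_comm, sdiff_sdiff_comm (a := X)] at s3
  exact (s3.insert_line hL'.1 hAL').insert_line hL.1 hAL

theorem IsPoised.ncard_eq_choose {m : ℕ} {X : Set Pt} (hX : IsPoised (m + 1) X) :
    X.ncard = (m + 2) + (m + 1) + Nat.choose (m + 1) 2 := by
  have h := hX.1
  have h1 : Nat.choose (m + 3) 2 = (m + 2) + ((m + 1) + Nat.choose (m + 1) 2) := by
    rw [Nat.choose_succ_succ' (m + 2) 1, Nat.choose_succ_succ' (m + 1) 1]
    simp
  rw [Nat.choose_two_right, Nat.mul_comm] at h1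
  have h2 : (m + 1 + 1) * (m + 1 + 2) / 2 = (m + 3 - 1) * (m + 3) / 2 := rfl
  omega

theorem useSet_succ_eq {m : ℕ} {X ℓ : Set Pt} (hℓ : IsLine ℓ) :
    UseSet (m + 1) X ℓ = {A ∈ X | A ∉ ℓ ∧ IsSep m (X \ ℓ) A} := by
  ext A
  exact and_congr_right fun _ => uses_iff_isSep hℓ

theorem IsDisjointMax.ncard_useSet {m : ℕ} {X ℓ L : Set Pt} (hX : IsPoised (m + 1) X)
    (hℓ : IsNodeLine (m + 1) X ℓ) (h : IsDisjointMax (m + 1) X ℓ L) :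
    (UseSet (m + 1) X ℓ).ncard = Nat.choose (m + 1) 2 := by
  have : UseSet (m + 1) X ℓ = (X \ L) \ ℓ := by
    rw [useSet_succ_eq hℓ.1]
    ext A
    exact ⟨fun ⟨h1, h2, h3⟩ => ⟨⟨h1, (h.isSep_iff hX hℓ h1 h2).1 h3⟩, h2⟩,
      fun ⟨⟨h1, h3⟩, h2⟩ => ⟨h1, h2, (h.isSep_iff hX hℓ h1 h2).2 h3⟩⟩
  have h1 := ncard_diff_line_add (L := L) hX.finite
  have h2 := ncard_diff_line_add (L := ℓ) (hX.finite.sdiff (t := L))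
  rw [diff_inter_of_miss (fun D h1 h2 h3 => h.2 D h1 h3 h2), hℓ.2] at h2
  rw [h.1.2] at h1
  have h3 := hX.ncard_eq_choose
  rw [this]
  omega

theorem IsMaxPair.ncard_useSet {m : ℕ} {X ℓ L L' : Set Pt} (hX : IsPoised (m + 1) X)
    (hℓ : IsNodeLine (m + 1) X ℓ) (h : IsMaxPair (m + 1) X ℓ L L') :
    (UseSet (m + 1) X ℓ).ncard = Nat.choose m 2 := by
  have : UseSet (m + 1) X ℓ = ((X \ L) \ L') \ ℓ := by
    rw [useSet_succ_eq hℓ.1]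
    ext A
    refine ⟨fun ⟨h1, h2, h3⟩ => ?_,
      fun ⟨⟨⟨h1, h3⟩, h4⟩, h2⟩ => ⟨h1, h2, (h.isSep_iff hX hℓ h1 h2).2 ⟨h3, h4⟩⟩⟩
    have := (h.isSep_iff hX hℓ h1 h2).1 h3
    exact ⟨⟨⟨h1, this.1⟩, this.2⟩, h2⟩
  obtain ⟨hL, hL', hne, B, hB, hBℓ, hBL, hBL'⟩ := h
  have h1 := ncard_diff_line_add (L := L) hX.finite
  have h2 := ncard_diff_line_add (L := L') (hX.finite.sdiff (t := L))
  have h4 := ncard_diff_line_add (L := ℓ) ((hX.finite.sdiff (t := L)).sdiff (t := L'))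
  have h5 := ncard_diff_diff_inter hX.finite hℓ.1 hL.1 hL'.1 (hℓ.ne_maxLine hL)
    (hℓ.ne_maxLine hL') hB hBℓ hBL hBL'
  rw [hℓ.2] at h5
  rw [hL.2] at h1
  rw [(hL'.diff hX hL hne.symm).2] at h2
  have h3 := hX.ncard_eq_choose
  have h6 : Nat.choose (m + 1) 2 = m + Nat.choose m 2 := by
    rw [Nat.choose_succ_succ' m 1, Nat.choose_one_right]
  rw [this]
  omega

/-- The existence of a maximal line, or of a pair of maximal lines, that determines which nodes
use `ℓ`. -/
def HasConfig (n : ℕ) (X ℓ : Set Pt) : Prop :=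
  (∃ L, IsDisjointMax n X ℓ L) ∨ ∃ L L', IsMaxPair n X ℓ L L'

theorem HasConfig.exists_hit {n : ℕ} {X ℓ L : Set Pt} (h : ¬ HasConfig n X ℓ)
    (hL : IsMaxLine n X L) : ∃ D ∈ X, D ∈ L ∧ D ∈ ℓ := by
  by_contra hd
  push Not at hd
  exact h (Or.inl ⟨L, hL, hd⟩)

theorem HasConfig.notMem {n : ℕ} {X ℓ L L' : Set Pt} (h : ¬ HasConfig n X ℓ)
    (hL : IsMaxLine n X L) (hL' : IsMaxLine n X L') (hne : L ≠ L') {D : Pt} (hD : D ∈ X)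
    (hDℓ : D ∈ ℓ) (hDL : D ∈ L) : D ∉ L' := fun hDL' =>
  h (Or.inr ⟨L, L', hL, hL', hne, D, hD, hDℓ, hDL, hDL'⟩)

theorem hasConfig_of_le_two {m : ℕ} {X ℓ : Set Pt} (hm : m ≤ 1) (hG : GMUpTo (m + 1))
    (hX : LineGC (m + 1) X) (hℓ : IsNodeLine (m + 1) X ℓ) : HasConfig (m + 1) X ℓ := by
  by_contra h
  obtain ⟨L₁, L₂, L₃, h1, h2, h3, h12, h13, h23⟩ := hX.three_maxLines hG
  obtain ⟨D₁, hD1, hDL1, hDℓ1⟩ := HasConfig.exists_hit h h1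
  obtain ⟨D₂, hD2, hDL2, hDℓ2⟩ := HasConfig.exists_hit h h2
  obtain ⟨D₃, hD3, hDL3, hDℓ3⟩ := HasConfig.exists_hit h h3
  have e12 : D₁ ≠ D₂ := by rintro rfl; exact HasConfig.notMem h h1 h2 h12 hD1 hDℓ1 hDL1 hDL2
  have e13 : D₁ ≠ D₃ := by rintro rfl; exact HasConfig.notMem h h1 h3 h13 hD1 hDℓ1 hDL1 hDL3
  have e23 : D₂ ≠ D₃ := by rintro rfl; exact HasConfig.notMem h h2 h3 h23 hD2 hDℓ2 hDL2 hDL3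
  have hsub : ({D₁, D₂, D₃} : Set Pt) ⊆ X ∩ ℓ := by
    rintro x (rfl | rfl | rfl)
    exacts [⟨hD1, hDℓ1⟩, ⟨hD2, hDℓ2⟩, ⟨hD3, hDℓ3⟩]
  have := Set.ncard_le_ncard hsub (hX.1.finite.inter_of_left ℓ)
  rw [Set.ncard_eq_three.2 ⟨_, _, _, e12, e13, e23, rfl⟩, hℓ.2] at this
  omega

theorem IsMaxLine.of_diff_diff {m : ℕ} {X L L' M : Set Pt} (hX : IsPoised (m + 2) X)
    (hL : IsMaxLine (m + 2) X L) (hL' : IsMaxLine (m + 2) X L') (hne : L ≠ L')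
    (hM : IsMaxLine (m + 1) (X \ L) M) (hM' : IsMaxLine (m + 1) (X \ L') M) :
    IsMaxLine (m + 2) X M := by
  obtain ⟨D, hD, hDM, hDL⟩ := hM'.meet (hX.diff_maxLine hL') (hL.diff hX hL' hne)
  exact hM.of_diff hX.finite hL.1 hD.1 hDM hDL

theorem IsLine.eq_or_eq_of_subset_union {L M M' S : Set Pt} (hL : IsLine L) (hM : IsLine M)
    (hM' : IsLine M') (hSL : S ⊆ L) (hS : S ⊆ M ∪ M') (hc : 3 ≤ S.ncard) : L = M ∨ L = M' := by
  by_contra! h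
  have h1 : ¬ 1 < (S ∩ M).ncard := fun hlt =>
    h.1 (hL.eq_of_one_lt_ncard hM (fun x hx => hSL hx.1) (fun x hx => hx.2) hlt)
  have h2 : ¬ 1 < (S ∩ M').ncard := fun hlt =>
    h.2 (hL.eq_of_one_lt_ncard hM' (fun x hx => hSL hx.1) (fun x hx => hx.2) hlt)
  have h3 := Set.ncard_union_le (S ∩ M) (S ∩ M')
  rw [← Set.inter_union_distrib_left, Set.inter_eq_left.2 hS] at h3
  omega

/-- The set `T` of nodes outside `L ∪ L' ∪ ℓ` that do not use `ℓ`, described through `X \ L`. -/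
theorem nonusers_dichotomy {k : ℕ} {X ℓ L L' T : Set Pt} {B B' : Pt}
    (hX : IsPoised (k + 2) X) (hL : IsMaxLine (k + 2) X L) (hL' : IsMaxLine (k + 2) X L')
    (hne : L ≠ L') (hℓ : IsNodeLine (k + 2) X ℓ) (hB : B ∈ X) (hBL : B ∈ L) (hBℓ : B ∈ ℓ)
    (hB' : B' ∈ X) (hBL' : B' ∈ L') (hBℓ' : B' ∈ ℓ) (hBB : B ≠ B')
    (hT : ∀ A, A ∈ T ↔ A ∈ X ∧ A ∉ L ∧ A ∉ L' ∧ A ∉ ℓ ∧ ¬ IsSep (k + 1) (X \ ℓ) A)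
    (h : HasConfig (k + 1) (X \ L) ℓ) :
    (∃ M, IsMaxLine (k + 1) (X \ L) M ∧ T ⊆ M ∧ T.ncard = k + 1 ∧
      ((∀ D ∈ X \ L, D ∈ M → D ∉ ℓ) ∨ B' ∈ M)) ∨
    ∃ M M', IsMaxPair (k + 1) (X \ L) ℓ M M' ∧ T ⊆ M ∪ M' ∧ (T ∩ M).ncard = k ∧
      (T ∩ M').ncard = k ∧ T.ncard = 2 * k := by
  have hfin := hX.finite
  have hZ : IsPoised (k + 1) (X \ L) := hX.diff_maxLine hL
  have hLZ : IsMaxLine (k + 1) (X \ L) L' := hL'.diff hX hL hne.symm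
  have hℓZ : IsNodeLine (k + 1) (X \ L) ℓ := by
    have := ncard_diff_inter_of_hit hfin hℓ.1 hL.1 (hℓ.ne_maxLine hL) hB hBℓ hBL
    rw [hℓ.2] at this
    exact ⟨hℓ.1, by omega⟩
  have hBL1 : B' ∉ L := fun h => hℓ.ne_maxLine hL (hℓ.1.eq_of_mem hL.1 hBB hBℓ hBℓ' hBL h)
  have huse : ∀ A ∈ X, A ∉ L → A ∉ ℓ → (IsSep (k + 1) (X \ ℓ) A ↔ IsSep k ((X \ L) \ ℓ) A) := by
    intro A hA hAL hAℓ
    rw [sdiff_sdiff_comm]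
    refine ⟨fun hs => hs.remove_succ hL.1 hAL ?_, fun hs => hs.insert_line hL.1 hAL⟩
    have := ncard_diff_inter_of_hit hfin hL.1 hℓ.1 (hℓ.ne_maxLine hL).symm hB hBL hBℓ
    rw [hL.2] at this
    omega
  have hT' : ∀ A, A ∈ T ↔ A ∈ X \ L ∧ A ∉ L' ∧ A ∉ ℓ ∧ ¬ IsSep k ((X \ L) \ ℓ) A := by
    intro A
    rw [hT]
    constructor
    · rintro ⟨h1, h2, h3, h4, h5⟩
      exact ⟨⟨h1, h2⟩, h3, h4, fun h => h5 ((huse A h1 h2 h4).2 h)⟩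
    · rintro ⟨⟨h1, h2⟩, h3, h4, h5⟩
      exact ⟨h1, h2, h3, h4, fun h => h5 ((huse A h1 h2 h4).1 h)⟩
  rcases h with ⟨M, hM⟩ | ⟨M, M', hM⟩
  · have hML : M ≠ L' := by
      rintro rfl
      exact hM.2 B' ⟨hB', hBL1⟩ hBL' hBℓ'
    have hTM : T = ((X \ L) \ L') ∩ M := by
      ext A
      rw [hT']
      constructor
      · rintro ⟨h1, h2, h3, h4⟩
        exact ⟨⟨h1, h2⟩, by rwa [hM.isSep_iff hZ hℓZ h1 h3, not_not] at h4⟩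
      · rintro ⟨⟨h1, h2⟩, h4⟩
        have h3 := hM.2 A h1 h4
        exact ⟨h1, h2, h3, by rwa [hM.isSep_iff hZ hℓZ h1 h3, not_not]⟩
    refine Or.inl ⟨M, hM.1, hTM.trans_subset Set.inter_subset_right, ?_, Or.inl hM.2⟩
    rw [hTM]
    exact (hM.1.diff hZ hLZ hML).2
  · have hcase : ∀ M', IsMaxPair (k + 1) (X \ L) ℓ L' M' →
        (∃ M, IsMaxLine (k + 1) (X \ L) M ∧ T ⊆ M ∧ T.ncard = k + 1 ∧
          ((∀ D ∈ X \ L, D ∈ M → D ∉ ℓ) ∨ B' ∈ M)) := by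
      intro M hM
      have hiff := fun A h1 h2 => hM.isSep_iff hZ hℓZ (A := A) h1 h2
      obtain ⟨-, hMM, hne', C, hC, hCℓ, hCL, hCM⟩ := hM
      obtain rfl : C = B' := by
        by_contra hCB
        exact hℓZ.ne_maxLine hLZ (hℓ.1.eq_of_mem hLZ.1 hCB hCℓ hBℓ' hCL hBL')
      have hTM : T = ((X \ L) \ L') ∩ M := by
        ext A
        rw [hT']
        constructor
        · rintro ⟨h1, h2, h3, h4⟩
          rw [hiff A h1 h3] at h4
          exact ⟨⟨h1, h2⟩, by tauto⟩
        · rintro ⟨⟨h1, h2⟩, h4⟩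
          have h3 : A ∉ ℓ := fun h => hℓZ.ne_maxLine hMM
            (hℓ.1.eq_of_mem hMM.1 (P := A) (by rintro rfl; exact h2 hCL) h hCℓ h4 hCM)
          exact ⟨h1, h2, h3, by rw [hiff A h1 h3]; tauto⟩
      refine ⟨M, hMM, hTM.trans_subset Set.inter_subset_right, ?_, Or.inr hCM⟩
      rw [hTM]
      exact (hMM.diff hZ hLZ hne'.symm).2
    by_cases e1 : M = L'
    · exact Or.inl (hcase M' (e1 ▸ hM))
    by_cases e2 : M' = L'
    · exact Or.inl (hcase M (e2 ▸ hM.symm))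
    refine Or.inr ⟨M, M', hM, ?_⟩
    have hiff := fun A h1 h2 => hM.isSep_iff hZ hℓZ (A := A) h1 h2
    obtain ⟨h1, h2, h12, C, hC, hCℓ, hCM, hCM'⟩ := hM
    have hCL : C ∉ L' := h1.not_concurrent hZ h2 hLZ h12 e1 e2 hCM hCM'
    have hTM : ∀ A, A ∈ T ↔ A ∈ (X \ L) \ L' ∧ A ∉ ℓ ∧ (A ∈ M ∨ A ∈ M') := by
      intro A
      rw [hT']
      constructor
      · rintro ⟨h1, h2, h3, h4⟩
        rw [hiff A h1 h3] at h4
        exact ⟨⟨h1, h2⟩, h3, by tauto⟩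
      · rintro ⟨⟨h1, h2⟩, h3, h4⟩
        exact ⟨h1, h2, h3, by rw [hiff A h1 h3]; tauto⟩
    have hcount : ∀ N, IsMaxLine (k + 1) (X \ L) N → C ∈ N → N ≠ L' → (N = M ∨ N = M') →
        (T ∩ N).ncard = k := by
      intro N hN hCN hNL hNM
      have hTN : T ∩ N = (((X \ L) \ L') \ ℓ) ∩ N := by
        ext A
        simp only [Set.mem_inter_iff, hTM, Set.mem_sdiff]
        rcases hNM with rfl | rfl <;> tauto
      have := ncard_diff_inter_of_hit ((hfin.sdiff (t := L)).sdiff (t := L')) hN.1 hℓ.1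
        (hℓZ.ne_maxLine hN).symm ⟨hC, hCL⟩ hCN hCℓ
      rw [(hN.diff hZ hLZ hNL).2] at this
      rw [hTN]
      omega
    have c1 := hcount M h1 hCM e1 (Or.inl rfl)
    have c2 := hcount M' h2 hCM' e2 (Or.inr rfl)
    have hTs : T ⊆ M ∪ M' := fun A hA => ((hTM A).1 hA).2.2
    have hTfin : T.Finite := hfin.subset fun A hA => ((hT A).1 hA).1
    refine ⟨hTs, c1, c2, ?_⟩
    have hdisj : Disjoint (T ∩ M) (T ∩ M') := by
      rw [Set.disjoint_left]
      rintro A ⟨hA, hAM⟩ ⟨-, hAM'⟩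
      have : A ≠ C := by
        rintro rfl
        exact ((hTM A).1 hA).2.1 hCℓ
      exact h12 (h1.1.eq_of_mem h2.1 this hAM hCM hAM' hCM')
    have := Set.ncard_union_eq hdisj (hTfin.inter_of_left M) (hTfin.inter_of_left M')
    rw [← Set.inter_union_distrib_left, Set.inter_eq_left.2 hTs] at this
    omega

theorem hasConfig_step {k : ℕ} {X ℓ : Set Pt} (hk : 3 ≤ k) (hG : GMUpTo (k + 2))
    (hX : LineGC (k + 2) X) (hℓ : IsNodeLine (k + 2) X ℓ)
    (ih : ∀ Y, LineGC (k + 1) Y → IsNodeLine (k + 1) Y ℓ → HasConfig (k + 1) Y ℓ) :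
    HasConfig (k + 2) X ℓ := by
  by_contra h
  have hfin := hX.1.finite
  obtain ⟨L, L', -, hL, hL', -, hne, -, -⟩ := hX.three_maxLines hG
  obtain ⟨B, hB, hBL, hBℓ⟩ := HasConfig.exists_hit h hL
  obtain ⟨B', hB', hBL', hBℓ'⟩ := HasConfig.exists_hit h hL'
  have hBB : B ≠ B' := by rintro rfl; exact HasConfig.notMem h hL hL' hne hB hBℓ hBL hBL'
  have hconf : ∀ {N C}, IsMaxLine (k + 2) X N → C ∈ X → C ∈ N → C ∈ ℓ →
      HasConfig (k + 1) (X \ N) ℓ := by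
    intro N C hN hC hCN hCℓ
    refine ih _ (hX.diff_maxLine hN) ⟨hℓ.1, ?_⟩
    have := ncard_diff_inter_of_hit hfin hℓ.1 hN.1 (hℓ.ne_maxLine hN) hC hCℓ hCN
    rw [hℓ.2] at this
    omega
  set T : Set Pt := {A | A ∈ X ∧ A ∉ L ∧ A ∉ L' ∧ A ∉ ℓ ∧ ¬ IsSep (k + 1) (X \ ℓ) A} with hTdef
  have d1 := nonusers_dichotomy (T := T) hX.1 hL hL' hne hℓ hB hBL hBℓ hB' hBL' hBℓ' hBB
    (fun A => Iff.rfl) (hconf hL hB hBL hBℓ)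
  have d2 := nonusers_dichotomy (T := T) hX.1 hL' hL hne.symm hℓ hB' hBL' hBℓ' hB hBL hBℓ hBB.symm
    (fun A => by rw [hTdef]; constructor <;> rintro ⟨h1, h2, h3, h4⟩ <;> exact ⟨h1, h3, h2, h4⟩)
    (hconf hL' hB' hBL' hBℓ')
  rcases d1 with ⟨M, hM, hTM, hTc, hMc⟩ | ⟨M, M', hM, hTM, hc, hc', hTc⟩
  · rcases d2 with ⟨N, hN, hTN, -, hNc⟩ | ⟨-, -, -, -, -, -, hTc'⟩
    · obtain rfl : M = N := hM.1.eq_of_one_lt_ncard hN.1 hTM hTN (by omega)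
      have hMX := IsMaxLine.of_diff_diff hX.1 hL hL' hne hM hN
      rcases hMc with hMc | hMc
      · obtain ⟨D, hD, hDM, hDℓ⟩ := HasConfig.exists_hit h hMX
        exact hMc D ⟨hD, HasConfig.notMem h hMX hL hM.ne_of_diff hD hDℓ hDM⟩ hDM hDℓ
      · exact HasConfig.notMem h hMX hL' hN.ne_of_diff hB' hBℓ' hMc hBL'
    · omega
  · rcases d2 with ⟨-, -, -, hTc', -⟩ | ⟨N, N', hN, hTN, -, -, -⟩
    · omega
    · obtain ⟨h1, h2, h12, C, hC, hCℓ, hCM, hCM'⟩ := hM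
      obtain ⟨k1, k2, -⟩ := hN
      have key : ∀ {R}, IsMaxLine (k + 1) (X \ L) R → (T ∩ R).ncard = k →
          IsMaxLine (k + 2) X R := by
        intro R hR hRc
        have := hR.1.eq_or_eq_of_subset_union k1.1 k2.1 (S := T ∩ R) (fun x hx => hx.2)
          (fun x hx => hTN hx.1) (by omega)
        refine IsMaxLine.of_diff_diff hX.1 hL hL' hne hR ?_
        rcases this with rfl | rfl
        exacts [k1, k2]
      exact h (Or.inr ⟨M, M', key h1 hc, key h2 hc', h12, C, hC.1, hCℓ, hCM, hCM'⟩)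

theorem List.Nodup.length_le_ncard {α : Type*} {l : List α} {S : Set α} (hl : l.Nodup)
    (hS : S.Finite) (h : ∀ x ∈ l, x ∈ S) : l.length ≤ S.ncard := by
  classical
  rw [← List.toFinset_card_of_nodup hl, ← Set.ncard_coe_finset]
  exact Set.ncard_le_ncard (fun x hx => h x (by simpa using hx)) hS

theorem LineGC.exists_maxLine_ne_ne {m : ℕ} {X : Set Pt} (hG : GMUpTo (m + 1))
    (hX : LineGC (m + 1) X) (L L' : Set Pt) : ∃ M, IsMaxLine (m + 1) X M ∧ M ≠ L ∧ M ≠ L' := by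
  obtain ⟨L₁, L₂, L₃, h1, h2, h3, h12, h13, h23⟩ := hX.three_maxLines hG
  by_contra! h
  have k1 := h L₁ h1
  have k2 := h L₂ h2
  have k3 := h L₃ h3
  by_cases e1 : L₁ = L
  · exact h23 ((k2 fun e => h12 (e1.trans e.symm)).trans (k3 fun e => h13 (e1.trans e.symm)).symm)
  · by_cases e2 : L₂ = L
    · exact h13 ((k1 e1).trans (k3 fun e => h23 (e2.trans e.symm)).symm)
    · exact h12 ((k1 e1).trans (k2 e2).symm)

theorem LineGC.exists_third_maxLine_two {Q L L' : Set Pt} (hG : GMUpTo 2) (hQ : LineGC 2 Q)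
    (hL : IsMaxLine 2 Q L) (hL' : IsMaxLine 2 Q L') (hne : L ≠ L') :
    ∃ K P R O, IsLine K ∧ (P ∈ Q ∧ P ∈ K ∧ P ∈ L ∧ P ∉ L') ∧ (R ∈ Q ∧ R ∈ K ∧ R ∈ L' ∧ R ∉ L) ∧
      O ∈ Q ∧ O ∈ K ∧ O ∉ L ∧ O ∉ L' := by
  obtain ⟨K, hK, h1, h2⟩ := hQ.exists_maxLine_ne_ne hG L L'
  obtain ⟨P, hP, hPK, hPL⟩ := hK.meet hQ.1 hL
  obtain ⟨R, hR, hRK, hRL⟩ := hK.meet hQ.1 hL'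
  have h3 := (hK.diff hQ.1 hL h1).diff (hQ.diff_maxLine hL).1 (hL'.diff hQ.1 hL hne.symm) h2
  obtain ⟨O, ⟨⟨hO, hOL⟩, hOL'⟩, hOK⟩ := Set.nonempty_of_ncard_ne_zero (h3.2.trans_ne one_ne_zero)
  exact ⟨K, P, R, O, hK.1, ⟨hP, hPK, hPL, hK.not_concurrent hQ.1 hL hL' h1 h2 hne hPK hPL⟩,
    ⟨hR, hRK, hRL, hK.not_concurrent hQ.1 hL' hL h2 h1 hne.symm hRK hRL⟩, hO, hOK, hOL, hOL'⟩

/-- The combinatorial core of the case of four maximal lines in degree `4`. -/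
theorem no_four_labels {α : Type*} (s t : Fin 4 → α) (ht : ∀ i j, i ≠ j → t i ≠ t j)
    (h : ∀ i j, i ≠ j → s i = s j ∨ s i = t j ∨ t i = s j)
    (h1 : ¬ ∀ i, s i = s 0) (h2 : ∀ k, ¬ ∀ i, i ≠ k → s i = t k) : False := by
  have e : ∀ i : Fin 4, i = 0 ∨ i = 1 ∨ i = 2 ∨ i = 3 := by decide
  have t01 := ht 0 1 (by decide)
  have t02 := ht 0 2 (by decide)
  have t03 := ht 0 3 (by decide)
  have t12 := ht 1 2 (by decide)
  have t13 := ht 1 3 (by decide)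
  have t23 := ht 2 3 (by decide)
  have a01 := h 0 1 (by decide)
  have a02 := h 0 2 (by decide)
  have a03 := h 0 3 (by decide)
  have a12 := h 1 2 (by decide)
  have a13 := h 1 3 (by decide)
  have a23 := h 2 3 (by decide)
  have k1 : ¬ (s 1 = s 0 ∧ s 2 = s 0 ∧ s 3 = s 0) := fun ⟨x, y, z⟩ => h1 fun i => by
    rcases e i with rfl | rfl | rfl | rfl <;> simp [*]
  have b0 : ¬ (s 1 = t 0 ∧ s 2 = t 0 ∧ s 3 = t 0) := fun ⟨x, y, z⟩ => h2 0 fun i hi => by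
    rcases e i with rfl | rfl | rfl | rfl <;> first | exact absurd rfl hi | assumption
  have b1 : ¬ (s 0 = t 1 ∧ s 2 = t 1 ∧ s 3 = t 1) := fun ⟨x, y, z⟩ => h2 1 fun i hi => by
    rcases e i with rfl | rfl | rfl | rfl <;> first | exact absurd rfl hi | assumption
  have b2 : ¬ (s 0 = t 2 ∧ s 1 = t 2 ∧ s 3 = t 2) := fun ⟨x, y, z⟩ => h2 2 fun i hi => by
    rcases e i with rfl | rfl | rfl | rfl <;> first | exact absurd rfl hi | assumption
  have b3 : ¬ (s 0 = t 3 ∧ s 1 = t 3 ∧ s 2 = t 3) := fun ⟨x, y, z⟩ => h2 3 fun i hi => by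
    rcases e i with rfl | rfl | rfl | rfl <;> first | exact absurd rfl hi | assumption
  clear h h1 h2 ht e
  generalize s 0 = s0 at *
  generalize s 1 = s1 at *
  generalize s 2 = s2 at *
  generalize s 3 = s3 at *
  generalize t 0 = t0 at *
  generalize t 1 = t1 at *
  generalize t 2 = t2 at *
  generalize t 3 = t3 at *
  grind

theorem IsPoised.isMaxLine_of_list {n : ℕ} {X N : Set Pt} (hX : IsPoised n X) (hN : IsLine N)
    {l : List Pt} (hl : l.Nodup) (hlen : n + 1 ≤ l.length) (h : ∀ x ∈ l, x ∈ X ∩ N) :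
    IsMaxLine n X N :=
  ⟨hN, (hX.ncard_inter_line_le hN).antisymm
    (hlen.trans (hl.length_le_ncard (hX.finite.inter_of_left N) h))⟩

theorem hasConfig_four_of_four_maxLines {X ℓ : Set Pt} (hG : GMUpTo 4) (hX : LineGC 4 X)
    (hℓ : IsNodeLine 4 X ℓ) (L : Fin 4 → Set Pt) (hL : ∀ i, IsMaxLine 4 X (L i))
    (hLne : ∀ i j, i ≠ j → L i ≠ L j) : HasConfig 4 X ℓ := by
  by_contra h
  have hfin := hX.1.finite
  choose B hB hBL hBℓ using fun i => HasConfig.exists_hit h (hL i)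
  have hBn : ∀ i j, i ≠ j → B i ∉ L j := fun i j hij =>
    HasConfig.notMem h (hL i) (hL j) (hLne i j hij) (hB i) (hBℓ i) (hBL i)
  have hBne : ∀ i j, i ≠ j → B i ≠ B j := fun i j hij e => hBn i j hij (e ▸ hBL j)
  have hcov : ∀ i j : Fin 4, i ≠ j → ∃ k l, k ≠ l ∧ i ≠ k ∧ i ≠ l ∧ j ≠ k ∧ j ≠ l ∧
      ∀ x, x = i ∨ x = j ∨ x = k ∨ x = l := by decide
  have h3 : ∀ k, LineGC 3 (X \ L k) := fun k => hX.diff_maxLine (hL k)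
  have m3 : ∀ i k, i ≠ k → IsMaxLine 3 (X \ L k) (L i) := fun i k hik =>
    (hL i).diff hX.1 (hL k) (hLne i k hik)
  have h2 : ∀ k l, k ≠ l → LineGC 2 ((X \ L k) \ L l) := fun k l hkl =>
    (h3 k).diff_maxLine (m3 l k hkl.symm)
  have m2 : ∀ i k l, i ≠ k → i ≠ l → k ≠ l → IsMaxLine 2 ((X \ L k) \ L l) (L i) :=
    fun i k l hik hil hkl => (m3 i k hik).diff (h3 k).1 (m3 l k hkl.symm) (hLne i l hil)
  obtain ⟨O, hO⟩ : ∃ O, ∀ D, (D ∈ X ∧ ∀ i, D ∉ L i) ↔ D = O := by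
    have d1 : LineGC 1 (((X \ L 0) \ L 1) \ L 2) :=
      (h2 0 1 (by decide)).diff_maxLine (m2 2 0 1 (by decide) (by decide) (by decide))
    have d0 : LineGC 0 ((((X \ L 0) \ L 1) \ L 2) \ L 3) :=
      d1.diff_maxLine ((m2 3 0 1 (by decide) (by decide) (by decide)).diff
        (h2 0 1 (by decide)).1 (m2 2 0 1 (by decide) (by decide) (by decide))
        (hLne 3 2 (by decide)))
    obtain ⟨O, hO⟩ := Set.ncard_eq_one.1 d0.1.1
    refine ⟨O, fun D => ?_⟩
    rw [← Set.mem_singleton_iff, ← hO]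
    simp only [Fin.forall_fin_succ, Set.mem_sdiff]
    simp
    tauto
  obtain ⟨hOX, hOL⟩ := (hO O).2 rfl
  have ha : ∀ i, ∃ a, a ∈ X ∧ a ∈ L i ∧ (∀ j, i ≠ j → a ∉ L j) ∧
      ∀ x ∈ X, x ∈ L i → (∀ j, i ≠ j → x ∉ L j) → x = B i ∨ x = a := by
    intro i
    obtain ⟨j, hij⟩ : ∃ j, i ≠ j := (exists_ne i).imp fun _ h => h.symm
    obtain ⟨k, l, hkl, hik, hil, hjk, hjl, hall⟩ := hcov i j hij
    have hm := (m2 i k l hik hil hkl).diff (h2 k l hkl).1 (m2 j k l hjk hjl hkl) (hLne i j hij)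
    have hmem : ∀ x, x ∈ (((X \ L k) \ L l) \ L j) ∩ L i ↔
        x ∈ X ∧ x ∈ L i ∧ ∀ j, i ≠ j → x ∉ L j := by
      intro x
      constructor
      · rintro ⟨⟨⟨⟨h1, h2⟩, h3⟩, h4⟩, h5⟩
        refine ⟨h1, h5, fun r hr => ?_⟩
        rcases hall r with rfl | rfl | rfl | rfl
        exacts [absurd rfl hr, h4, h2, h3]
      · rintro ⟨h1, h2, h3⟩
        exact ⟨⟨⟨⟨h1, h3 k hik⟩, h3 l hil⟩, h3 j hij⟩, h2⟩
    obtain ⟨x, y, -, hxy⟩ := Set.ncard_eq_two.1 hm.2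
    have hBm := (hmem (B i)).2 ⟨hB i, hBL i, hBn i⟩
    rw [hxy] at hBm
    rcases hBm with e | e
    · obtain ⟨h1, h2, h3⟩ := (hmem y).1 (hxy ▸ by simp)
      refine ⟨y, h1, h2, h3, fun z k1 k2 k3 => ?_⟩
      have := (hmem z).2 ⟨k1, k2, k3⟩
      rw [hxy] at this
      rw [e]
      exact this
    · obtain ⟨h1, h2, h3⟩ := (hmem x).1 (hxy ▸ by simp)
      refine ⟨x, h1, h2, h3, fun z k1 k2 k3 => ?_⟩
      have := (hmem z).2 ⟨k1, k2, k3⟩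
      rw [hxy] at this
      rw [show B i = y from e]
      exact this.symm
  choose a haX haL haLn haB using ha
  have haa : ∀ i j, i ≠ j → a i ≠ a j := fun i j hij e => haLn i j hij (e ▸ haL j)
  have haBn : ∀ i j, i ≠ j → a i ≠ B j := fun i j hij e => haLn i j hij (e ▸ hBL j)
  have hOa : ∀ i, O ≠ a i := fun i e => hOL i (e ▸ haL i)
  have hOB : ∀ i, O ≠ B i := fun i e => hOL i (e ▸ hBL i)
  have hOℓ : O ∉ ℓ := by
    intro hOℓ
    have hnd : [O, B 0, B 1, B 2, B 3].Nodup := by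
      simp [hOB, hBne]
    have := hnd.length_le_ncard (hfin.inter_of_left ℓ) (by simp [hOX, hOℓ, hB, hBℓ])
    rw [hℓ.2] at this
    simp at this
  choose s hs hsO hsa using fun i => exists_isLine O (a i) (hOa i)
  choose t ht htO htB using fun i => exists_isLine O (B i) (hOB i)
  have htne : ∀ i j, i ≠ j → t i ≠ t j := by
    intro i j hij e
    have : t i = ℓ := (ht i).eq_of_mem hℓ.1 (hBne i j hij) (htB i) (e ▸ htB j) (hBℓ i) (hBℓ j)
    exact hOℓ (this ▸ htO i)
  refine no_four_labels s t htne ?_ ?_ ?_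
  · intro i j hij
    obtain ⟨k, l, hkl, hik, hil, hjk, hjl, hall⟩ := hcov i j hij
    obtain ⟨K, P, R, O', hK, ⟨hP, hPK, hPL, hPn⟩, ⟨hR, hRK, hRL, hRn⟩, hO', hOK, hO1, hO2⟩ :=
      (h2 k l hkl).exists_third_maxLine_two (hG.mono (by norm_num)) (m2 i k l hik hil hkl)
        (m2 j k l hjk hjl hkl) (hLne i j hij)
    obtain rfl : O' = O := (hO O').1 ⟨hO'.1.1, fun r => by
      rcases hall r with rfl | rfl | rfl | rfl
      exacts [hO1, hO2, hO'.1.2, hO'.2]⟩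
    have cP := haB i P hP.1.1 hPL (fun r hr => by
      rcases hall r with rfl | rfl | rfl | rfl
      exacts [absurd rfl hr, hPn, hP.1.2, hP.2])
    have cR := haB j R hR.1.1 hRL (fun r hr => by
      rcases hall r with rfl | rfl | rfl | rfl
      exacts [hRn, absurd rfl hr, hR.1.2, hR.2])
    have es : ∀ i, a i ∈ K → s i = K := fun i hi =>
      (hs i).eq_of_mem hK (hOa i) (hsO i) (hsa i) hOK hi
    have et : ∀ i, B i ∈ K → t i = K := fun i hi =>
      (ht i).eq_of_mem hK (hOB i) (htO i) (htB i) hOK hi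
    rcases cP with rfl | rfl <;> rcases cR with rfl | rfl
    · exact absurd ((et i hPK).trans (et j hRK).symm) (htne i j hij)
    · exact Or.inr (Or.inr ((et i hPK).trans (es j hRK).symm))
    · exact Or.inr (Or.inl ((es i hPK).trans (et j hRK).symm))
    · exact Or.inl ((es i hPK).trans (es j hRK).symm)
  · intro hall
    have hmem : ∀ i, a i ∈ s 0 := fun i => hall i ▸ hsa i
    have hmax : IsMaxLine 4 X (s 0) := hX.1.isMaxLine_of_list (hs 0)
      (l := [O, a 0, a 1, a 2, a 3]) (by simp [hOa, haa]) (by simp) (by simp [hOX, haX, hmem, hsO])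
    obtain ⟨D, hD, hDs, hDℓ⟩ := HasConfig.exists_hit h hmax
    have hne : ∀ i, s 0 ≠ L i := fun i e => hOL i (e ▸ hsO 0)
    have := (hO D).1 ⟨hD, fun i => HasConfig.notMem h hmax (hL i) (hne i) hD hDℓ hDs⟩
    exact hOℓ (this ▸ hDℓ)
  · intro k hall
    obtain ⟨i, hki⟩ : ∃ i, k ≠ i := (exists_ne k).imp fun _ h => h.symm
    obtain ⟨j, l, hjl, hkj, hkl, hij, hil, -⟩ := hcov k i hki
    have hmem : ∀ i, k ≠ i → a i ∈ t k := fun i hi => hall i hi.symm ▸ hsa i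
    have hmax : IsMaxLine 4 X (t k) := hX.1.isMaxLine_of_list (ht k)
      (l := [O, B k, a i, a j, a l])
      (by simp [hOa, haa, hOB, hij, hil, hjl, (haBn i k hki.symm).symm, (haBn j k hkj.symm).symm,
        (haBn l k hkl.symm).symm]) (by simp)
      (by simp [hOX, haX, hmem, htO, hB, htB, hki, hkj, hkl])
    exact HasConfig.notMem h hmax (hL k) (fun e => hOL k (e ▸ htO k)) (hB k) (hBℓ k) (htB k) (hBL k)

theorem mem_of_three_maxLines {X ℓ : Set Pt} (hG : GMUpTo 4) (hX : LineGC 4 X) (hℓ : IsLine ℓ)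
    {L M : Fin 3 → Set Pt} {B c : Fin 3 → Pt} (hL : ∀ i, IsMaxLine 4 X (L i))
    (hLne : ∀ i j, i ≠ j → L i ≠ L j) (hM : ∀ i, IsMaxLine 3 (X \ L i) (M i))
    (hMne : ∀ i j, i ≠ j → M i ≠ L j) (hmiss : ∀ i, ∀ D ∈ X, D ∈ M i → D ∉ L i)
    (hB : ∀ i, B i ∈ X) (hBL : ∀ i, B i ∈ L i) (hBℓ : ∀ i, B i ∈ ℓ)
    (hBn : ∀ i j, i ≠ j → B i ∉ L j)
    (hcL : ∀ i j, c i ∉ L j)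
    (hcM : ∀ i j, i ≠ j → c i ∈ M j)
    (hcM' : ∀ D ∈ X, (∀ j, D ∉ L j) → ∀ i, D ∉ M i → D = c i)
    {i j k : Fin 3} (hij : i ≠ j) (hik : i ≠ k) (hjk : j ≠ k) (hci : c i ∈ ℓ) (hck : c k ∉ ℓ) :
    B j ∈ M i := by
  have hfin := hX.1.finite
  have hall : ∀ x, x = i ∨ x = j ∨ x = k := by
    clear hci hck
    decide +revert
  have hZ : ∀ i, LineGC 3 (X \ L i) := fun i => hX.diff_maxLine (hL i)
  have hLZ : ∀ i j, i ≠ j → IsMaxLine 3 (X \ L j) (L i) := fun i j hij =>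
    (hL i).diff hX.1 (hL j) (hLne i j hij)
  have hMMne : ∀ i j, i ≠ j → M i ≠ M j := by
    intro i j hij e
    obtain ⟨D, hD, hDM, hDL⟩ := (hM i).meet (hZ i).1 (hLZ j i hij.symm)
    exact hmiss j D hD.1 (e ▸ hDM) hDL
  have hcross : ∀ i j, i ≠ j → ∃ D ∈ X, D ∈ M i ∧ D ∈ L j ∧ ∀ r, r ≠ j → D ∉ L r := by
    intro i j hij
    obtain ⟨D, hD, hDM, hDL⟩ := (hM i).meet (hZ i).1 (hLZ j i hij.symm)
    refine ⟨D, hD.1, hDM, hDL, fun r hr => ?_⟩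
    by_cases hri : r = i
    · exact hri ▸ hD.2
    · exact (hM i).not_concurrent (hZ i).1 (hLZ j i hij.symm) (hLZ r i hri) (hMne i j hij)
        (hMne i r (Ne.symm hri)) (hLne j r hr.symm) hDM hDL
  have hV : ∀ i j k, i ≠ j → i ≠ k → j ≠ k → ∃ V ∈ X, V ∈ L i ∧ V ∈ L j ∧ V ∉ L k := by
    intro i j k hij hik hjk
    obtain ⟨V, hV, h1, h2⟩ := (hL i).meet hX.1 (hL j)
    exact ⟨V, hV, h1, h2, (hL i).not_concurrent hX.1 (hL j) (hL k) (hLne i j hij) (hLne i k hik)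
      (hLne j k hjk) h1 h2⟩
  have hfive : ∀ r (l : List Pt), l.Nodup → (∀ x ∈ l, x ∈ X ∩ L r) → l.length ≤ 5 := by
    intro r l hl hmem
    exact (hl.length_le_ncard (hfin.inter_of_left _) hmem).trans_eq (hL r).2
  have hBc : ∀ r s, B r ≠ c s := fun r s e => hcL s r (e ▸ hBL r)
  have hBM : ∀ r s, s ≠ i → B r ∉ M s := by
    intro r s hs hBM
    have e : M s = ℓ := (hM s).1.eq_of_mem hℓ (hBc r i) hBM (hcM i s hs.symm) (hBℓ r) hci
    exact hmiss s (B s) (hB s) (e ▸ hBℓ s) (hBL s)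
  have hMM : ∀ r s t D, r ≠ s → r ≠ t → s ≠ t → D ∈ M r → D ∈ M s → ∀ u, D ∉ L u := by
    intro r s t D hrs hrt hst hDr hDs u hDu
    refine hMMne r s hrs ((hM r).1.eq_of_mem (hM s).1 (P := D) (Q := c t) ?_ hDr
      (hcM t r hrt.symm) hDs (hcM t s hst.symm))
    rintro rfl
    exact hcL t u hDu
  have hQ : LineGC 2 ((X \ L k) \ M k) := (hZ k).diff_maxLine (hM k)
  have hQL : ∀ r, r ≠ k → IsMaxLine 2 ((X \ L k) \ M k) (L r) := fun r hr =>
    (hLZ r k hr).diff (hZ k).1 (hM k) (hMne k r hr.symm).symm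
  obtain ⟨K, P, R, O, hK, ⟨hP, hPK, hPi, hPj⟩, ⟨hR, hRK, hRj, hRi⟩, hO, hOK, hOi, hOj⟩ :=
    hQ.exists_third_maxLine_two (hG.mono (by norm_num)) (hQL i hik) (hQL j hjk) (hLne i j hij)
  obtain rfl : O = c k := hcM' O hO.1.1 (fun r => by
    rcases hall r with rfl | rfl | rfl
    exacts [hOi, hOj, hO.1.2]) k hO.2
  obtain ⟨⟨hPX, hPk⟩, hPM⟩ := hP
  obtain ⟨⟨hRX, hRk⟩, hRM⟩ := hR
  obtain ⟨V, hVX, hVi, hVj, hVk⟩ := hV i j k hij hik hjk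
  obtain ⟨W, hWX, hWi, hWk, hWj⟩ := hV i k j hik hij hjk.symm
  obtain ⟨U, hUX, hUj, hUk, hUi⟩ := hV j k i hjk hij.symm hik.symm
  obtain ⟨a₂, ha2X, ha2M, ha2L, ha2n⟩ := hcross j i hij.symm
  obtain ⟨a₃, ha3X, ha3M, ha3L, ha3n⟩ := hcross k i hik.symm
  obtain ⟨b₁, hb1X, hb1M, hb1L, hb1n⟩ := hcross i j hij
  obtain ⟨b₃, hb3X, hb3M, hb3L, hb3n⟩ := hcross k j hjk.symm
  have hPa : P ≠ a₂ := by
    rintro rfl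
    have e : K = M j := hK.eq_of_mem (hM j).1 (P := P) (Q := c k)
      (by rintro rfl; exact hcL k i hPi) hPK hOK ha2M (hcM k j hjk.symm)
    exact hmiss j R hRX (e ▸ hRK) hRj
  have hPB : P = B i := by
    by_contra hPB
    have := hfive i [V, W, B i, a₂, a₃, P] (by
      have n1 : ∀ {x y : Pt} {S : Set Pt}, x ∈ S → y ∉ S → x ≠ y := by
        rintro x y S h1 h2 rfl; exact h2 h1
      have n2 : ∀ {x y : Pt} {S : Set Pt}, x ∉ S → y ∈ S → x ≠ y := by
        rintro x y S h1 h2 rfl; exact h1 h2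
      have e1 : V ≠ W := n1 hVj hWj
      have e2 : V ≠ B i := n1 hVj (hBn i j hij)
      have e3 : V ≠ a₂ := n1 hVj (ha2n j hij.symm)
      have e4 : V ≠ a₃ := n1 hVj (ha3n j hij.symm)
      have e5 : V ≠ P := n1 hVj hPj
      have e6 : W ≠ B i := n1 hWk (hBn i k hik)
      have e7 : W ≠ a₂ := n1 hWk (ha2n k hik.symm)
      have e8 : W ≠ a₃ := n1 hWk (ha3n k hik.symm)
      have e9 : W ≠ P := n1 hWk hPk
      have e10 : B i ≠ a₂ := n2 (hBM i j hij.symm) ha2M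
      have e11 : B i ≠ a₃ := n2 (hBM i k hik.symm) ha3M
      have e12 : a₂ ≠ a₃ := by
        rintro rfl
        exact hMM j k i a₂ hjk hij.symm hik.symm ha2M ha3M i ha2L
      have e13 : a₃ ≠ P := n1 ha3M hPM
      simp [*, hPa.symm, Ne.symm hPB]) (by simp [*])
    simp at this
  subst hPB
  have hRB : R ≠ B j := by
    rintro rfl
    have e : K = ℓ := hK.eq_of_mem hℓ (P := B i) (Q := B j)
      (by intro e; exact hBn i j hij (e ▸ hBL j)) hPK hRK (hBℓ i) (hBℓ j)
    exact hck (e ▸ hOK)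
  have hRb : R ≠ b₁ := by
    rintro rfl
    have e : K = M i := hK.eq_of_mem (hM i).1 (P := R) (Q := c k)
      (by rintro rfl; exact hcL k j hRj) hRK hOK hb1M (hcM k i hik.symm)
    exact hmiss i (B i) hPX (e ▸ hPK) hPi
  by_contra hBj
  have := hfive j [V, U, B j, b₁, b₃, R] (by
    have n1 : ∀ {x y : Pt} {S : Set Pt}, x ∈ S → y ∉ S → x ≠ y := by
      rintro x y S h1 h2 rfl; exact h2 h1
    have n2 : ∀ {x y : Pt} {S : Set Pt}, x ∉ S → y ∈ S → x ≠ y := by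
      rintro x y S h1 h2 rfl; exact h1 h2
    have e1 : V ≠ U := n1 hVi hUi
    have e2 : V ≠ B j := n1 hVi (hBn j i hij.symm)
    have e3 : V ≠ b₁ := n1 hVi (hb1n i hij)
    have e4 : V ≠ b₃ := n1 hVi (hb3n i hij)
    have e5 : V ≠ R := n1 hVi hRi
    have e6 : U ≠ B j := n1 hUk (hBn j k hjk)
    have e7 : U ≠ b₁ := n1 hUk (hb1n k hjk.symm)
    have e8 : U ≠ b₃ := n1 hUk (hb3n k hjk.symm)
    have e9 : U ≠ R := n1 hUk hRk
    have e10 : B j ≠ b₁ := n2 hBj hb1M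
    have e11 : B j ≠ b₃ := n2 (hBM j k hik.symm) hb3M
    have e12 : b₁ ≠ b₃ := by
      rintro rfl
      exact hMM i k j b₁ hik hij hjk.symm hb1M hb3M j hb1L
    have e13 : b₃ ≠ R := n1 hb3M hRM
    simp [*, hRb.symm, Ne.symm hRB]) (by simp [*])
  simp at this

theorem hasConfig_four_of_three_maxLines {X ℓ : Set Pt} (hG : GMUpTo 4) (hX : LineGC 4 X)
    (hℓ : IsNodeLine 4 X ℓ) (L : Fin 3 → Set Pt) (hL : ∀ i, IsMaxLine 4 X (L i))
    (hLne : ∀ i j, i ≠ j → L i ≠ L j) (honly : ∀ N, IsMaxLine 4 X N → ∃ i, N = L i) :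
    HasConfig 4 X ℓ := by
  by_contra h
  have hfin := hX.1.finite
  choose B hB hBL hBℓ using fun i => HasConfig.exists_hit h (hL i)
  have hBn : ∀ i j, i ≠ j → B i ∉ L j := fun i j hij =>
    HasConfig.notMem h (hL i) (hL j) (hLne i j hij) (hB i) (hBℓ i) (hBL i)
  have hBne : ∀ i j, i ≠ j → B i ≠ B j := fun i j hij e => hBn i j hij (e ▸ hBL j)
  have hZ : ∀ i, LineGC 3 (X \ L i) := fun i => hX.diff_maxLine (hL i)
  have hLZ : ∀ i j, i ≠ j → IsMaxLine 3 (X \ L j) (L i) := fun i j hij =>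
    (hL i).diff hX.1 (hL j) (hLne i j hij)
  have hcov : ∀ i : Fin 3, ∃ j k, i ≠ j ∧ i ≠ k ∧ j ≠ k ∧ ∀ x, x = i ∨ x = j ∨ x = k := by decide
  have hMex : ∀ i, ∃ M, IsMaxLine 3 (X \ L i) M ∧ ∀ j, i ≠ j → M ≠ L j := by
    intro i
    obtain ⟨j, k, -, -, -, hall⟩ := hcov i
    obtain ⟨M, hM, h1, h2⟩ := (hZ i).exists_maxLine_ne_ne (hG.mono (by norm_num)) (L j) (L k)
    refine ⟨M, hM, fun r hr => ?_⟩
    rcases hall r with rfl | rfl | rfl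
    exacts [absurd rfl hr, h1, h2]
  choose M hM hMne using hMex
  have hmiss : ∀ i, ∀ D ∈ X, D ∈ M i → D ∉ L i := by
    intro i D hD hDM hDL
    obtain ⟨r, hr⟩ := honly _ ((hM i).of_diff hfin (hL i).1 hD hDM hDL)
    by_cases e : i = r
    · exact (hM i).ne_of_diff (e ▸ hr)
    · exact hMne i r e hr
  have hMMne : ∀ i j, i ≠ j → M i ≠ M j := by
    intro i j hij e
    obtain ⟨D, hD, hDM, hDL⟩ := (hM i).meet (hZ i).1 (hLZ j i hij.symm)
    exact hmiss j D hD.1 (e ▸ hDM) hDL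
  set Y : Set Pt := {x ∈ X | ∀ i, x ∉ L i} with hY
  have hYeq : ∀ i j k, (∀ x, x = i ∨ x = j ∨ x = k) → ((X \ L i) \ L j) \ L k = Y := by
    intro i j k hall
    ext x
    constructor
    · rintro ⟨⟨⟨h1, h2⟩, h3⟩, h4⟩
      refine ⟨h1, fun r => ?_⟩
      rcases hall r with rfl | rfl | rfl
      exacts [h2, h3, h4]
    · rintro ⟨h1, h2⟩
      exact ⟨⟨⟨h1, h2 i⟩, h2 j⟩, h2 k⟩
  have h1 : LineGC 1 Y ∧ ∀ i, IsMaxLine 1 Y (M i) := by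
    have key : ∀ i, LineGC 1 Y ∧ IsMaxLine 1 Y (M i) := by
      intro i
      obtain ⟨j, k, hij, hik, hjk, hall⟩ := hcov i
      rw [← hYeq i j k hall]
      have h2 := (hZ i).diff_maxLine (hLZ j i hij.symm)
      have hk := (hLZ k i hik.symm).diff (hZ i).1 (hLZ j i hij.symm) (hLne k j hjk.symm)
      have hMi := (hM i).diff (hZ i).1 (hLZ j i hij.symm) (hMne i j hij)
      exact ⟨h2.diff_maxLine hk, hMi.diff h2.1 hk (hMne i k hik)⟩
    exact ⟨(key 0).1, fun i => (key i).2⟩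
  obtain ⟨hY1, hMY⟩ := h1
  have hYc : Y.ncard = 3 := hY1.1.1
  have hYfin := hY1.1.finite
  have hc : ∀ i, ∃ c, Y \ M i = {c} := fun i => by
    rw [← Set.ncard_eq_one]
    have h1 := ncard_diff_line_add (L := M i) hYfin
    rw [(hMY i).2, hYc] at h1
    omega
  choose c hc using hc
  have hcY : ∀ i, c i ∈ Y ∧ c i ∉ M i := fun i => by
    have : c i ∈ Y \ M i := by rw [hc i]; rfl
    exact this
  have hcM' : ∀ D ∈ X, (∀ j, D ∉ L j) → ∀ i, D ∉ M i → D = c i := by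
    intro D hD hDL i hDM
    have : D ∈ Y \ M i := ⟨⟨hD, hDL⟩, hDM⟩
    rwa [hc i] at this
  have hcne : ∀ i j, i ≠ j → c i ≠ c j := by
    intro i j hij e
    have hsub : Y ∩ M i ⊆ M j := by
      rintro x ⟨hx, hxM⟩
      by_contra hxj
      exact (hcY i).2 (by rw [e, ← hcM' x hx.1 hx.2 j hxj]; exact hxM)
    exact hMMne i j hij ((hM i).1.eq_of_one_lt_ncard (hM j).1 Set.inter_subset_right hsub
      (by rw [(hMY i).2]; norm_num))
  have hcM : ∀ i j, i ≠ j → c i ∈ M j := by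
    intro i j hij
    by_contra hn
    exact hcne i j hij (hcM' _ (hcY i).1.1 (hcY i).1.2 j hn)
  have hrange : ∀ x ∈ Y, ∃ i, x = c i := by
    intro x hx
    by_contra! hne
    have hnd : [x, c 0, c 1, c 2].Nodup := by simp [hne, hcne]
    have := hnd.length_le_ncard hYfin (by simp [hx, fun i => (hcY i).1])
    rw [hYc] at this
    simp at this
  have hℓc : ∃ O ∈ X, O ∈ ℓ ∧ ∀ i, O ∉ L i := by
    by_contra! hno
    have hsub : X ∩ ℓ ⊆ {B 0, B 1, B 2} := by
      rintro x ⟨hx, hxℓ⟩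
      obtain ⟨i, hi⟩ := hno x hx hxℓ
      have : x = B i := by
        by_contra hne
        exact hℓ.ne_maxLine (hL i) (hℓ.1.eq_of_mem (hL i).1 hne hxℓ (hBℓ i) hi (hBL i))
      subst this
      fin_cases i <;> simp
    have := Set.ncard_le_ncard hsub (by simp)
    rw [hℓ.2, Set.ncard_eq_three.2 ⟨_, _, _, hBne 0 1 (by decide), hBne 0 2 (by decide),
      hBne 1 2 (by decide), rfl⟩] at this
    omega
  obtain ⟨O, hO, hOℓ, hOL⟩ := hℓc
  obtain ⟨i, rfl⟩ := hrange O ⟨hO, hOL⟩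
  obtain ⟨j, k, hij, hik, hjk, -⟩ := hcov i
  have hcℓ : ∀ r, i ≠ r → c r ∉ ℓ := by
    intro r hr hrℓ
    have hnd : [B 0, B 1, B 2, c i, c r].Nodup := by
      have hBc : ∀ r s, B r ≠ c s := fun r s e => (hcY s).1.2 r (e ▸ hBL r)
      simp [hBne, hBc, hcne i r hr]
    have := hnd.length_le_ncard (hfin.inter_of_left ℓ) (by
      simp [hB, hBℓ, hOℓ, hrℓ, hO, (hcY r).1.1])
    rw [hℓ.2] at this
    simp at this
  have k1 : B j ∈ M i := mem_of_three_maxLines hG hX hℓ.1 hL hLne hM hMne hmiss hB hBL hBℓ hBn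
    (fun i => (hcY i).1.2) hcM hcM' hij hik hjk hOℓ (hcℓ k hik)
  have k2 : B k ∈ M i := mem_of_three_maxLines hG hX hℓ.1 hL hLne hM hMne hmiss hB hBL hBℓ hBn
    (fun i => (hcY i).1.2) hcM hcM' hik hij hjk.symm hOℓ (hcℓ j hij)
  have : ℓ = M i := hℓ.1.eq_of_mem (hM i).1 (hBne j k hjk) (hBℓ j) (hBℓ k) k1 k2
  exact (hcY i).2 (this ▸ hOℓ)

theorem hasConfig_four {X ℓ : Set Pt} (hG : GMUpTo 4) (hX : LineGC 4 X)
    (hℓ : IsNodeLine 4 X ℓ) : HasConfig 4 X ℓ := by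
  obtain ⟨L₁, L₂, L₃, h1, h2, h3, h12, h13, h23⟩ := hX.three_maxLines hG
  by_cases h : ∃ N, IsMaxLine 4 X N ∧ N ≠ L₁ ∧ N ≠ L₂ ∧ N ≠ L₃
  · obtain ⟨N, hN, e1, e2, e3⟩ := h
    refine hasConfig_four_of_four_maxLines hG hX hℓ ![N, L₁, L₂, L₃] ?_ ?_
    · simp [Fin.forall_fin_succ, *]
    · simp [Fin.forall_fin_succ, *, e1.symm, e2.symm, e3.symm, h12.symm, h13.symm, h23.symm]
  · push Not at h
    refine hasConfig_four_of_three_maxLines hG hX hℓ ![L₁, L₂, L₃] ?_ ?_ ?_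
    · simp [Fin.forall_fin_succ, *]
    · simp [Fin.forall_fin_succ, *, h12.symm, h13.symm, h23.symm]
    · intro N hN
      by_cases e1 : N = L₁
      · exact ⟨0, e1⟩
      by_cases e2 : N = L₂
      · exact ⟨1, e2⟩
      exact ⟨2, h N hN e1 e2⟩

theorem hasConfig_of_ge_four {n : ℕ} (hn : 4 ≤ n) {X ℓ : Set Pt} (hG : GMUpTo n)
    (hX : LineGC n X) (hℓ : IsNodeLine n X ℓ) : HasConfig n X ℓ := by
  induction n, hn using Nat.le_induction generalizing X with
  | base => exact hasConfig_four hG hX hℓ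
  | succ n hn ih =>
    obtain ⟨k, rfl⟩ : ∃ k, n = k + 1 := ⟨n - 1, by omega⟩
    exact hasConfig_step (by omega) hG hX hℓ fun Y hY hYℓ => ih (hG.mono (Nat.le_succ _)) hY hYℓ

/-- Assuming the Gasca–Maeztu conjecture up to degree `n`, for a `GC_n` set `X`
with `n ≥ 1`, `n ≠ 3`, any `n`-node line `ℓ` is used by exactly `C(n,2)` or exactly
`C(n-1,2)` nodes of `X`. -/
theorem nNodeLine_useSet_card (n : ℕ) (hn : 1 ≤ n) (hn3 : n ≠ 3)
    (GM : ∀ k : ℕ, 1 ≤ k → k ≤ n → ∀ Y : Set Pt, IsGC k Y → ∃ M : Set Pt, IsMaxLine k Y M)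
    (X ℓ : Set Pt) (hX : IsGC n X) (hℓ : IsNodeLine n X ℓ) :
    (UseSet n X ℓ).ncard = Nat.choose n 2 ∨
    (UseSet n X ℓ).ncard = Nat.choose (n - 1) 2 := by
  obtain ⟨m, rfl⟩ : ∃ m, n = m + 1 := ⟨n - 1, by omega⟩
  have hXL : LineGC (m + 1) X := ⟨hX.1, hX.hasLineCovers⟩
  have hG : GMUpTo (m + 1) := by
    intro k hk1 hk Y hY
    obtain ⟨j, rfl⟩ : ∃ j, k = j + 1 := ⟨k - 1, by omega⟩
    exact GM (j + 1) hk1 hk Y (hY.2.isGC hY.1)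
  have h : HasConfig (m + 1) X ℓ := by
    rcases Nat.lt_or_ge m 2 with hm | hm
    · exact hasConfig_of_le_two (by omega) hG hXL hℓ
    · exact hasConfig_of_ge_four (by omega) hG hXL hℓ
  rcases h with ⟨L, hL⟩ | ⟨L, L', hL⟩
  · exact Or.inl (hL.ncard_useSet hX.1 hℓ)
  · exact Or.inr (hL.ncard_useSet hX.1 hℓ)
end

section
/- Let X be a GC_3 set possessing exactly three maximal lines. Then every 3-node line ℓ of X is used either by exactly 3 nodes of X or by no node of X: |X_ℓ| = 3 or |X_ℓ| = 0. -/
open MvPolynomial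

theorem exists_eval_eq_of_totalDegree_eq_one {f : BPoly} (hf : f.totalDegree = 1) :
    ∃ a b c : ℝ, (a ≠ 0 ∨ b ≠ 0) ∧ ∀ x : Pt, eval x f = a * x 0 + b * x 1 + c := by
  have hdeg : ∀ d ∈ f.support, d 0 + d 1 ≤ 1 := by
    intro d hd
    have h := le_totalDegree hd
    rw [Finsupp.sum_fintype _ _ (by simp), Fin.sum_univ_two, hf] at h
    exact h
  have hsupp : f.support ⊆ {0, Finsupp.single 0 1, Finsupp.single 1 1} := by
    intro d hd
    have h := hdeg d hd
    have : (d 0 = 0 ∧ d 1 = 0) ∨ (d 0 = 1 ∧ d 1 = 0) ∨ (d 0 = 0 ∧ d 1 = 1) := by omega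
    simp only [Finset.mem_insert, Finset.mem_singleton]
    rcases this with h | h | h
    · left; ext i; fin_cases i <;> simp [h]
    · right; left; ext i; fin_cases i <;> simp [h]
    · right; right; ext i; fin_cases i <;> simp [h]
  refine ⟨coeff (Finsupp.single 0 1) f, coeff (Finsupp.single 1 1) f, coeff 0 f, ?_, ?_⟩
  · by_contra! h
    have : f = C (coeff 0 f) := by
      ext d
      rw [coeff_C]
      split_ifs with h0
      · rw [h0]
      · by_contra hd
        have := hsupp (mem_support_iff.2 hd)
        simp only [Finset.mem_insert, Finset.mem_singleton] at this
        rcases this with rfl | rfl | rfl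
        · exact h0 rfl
        · exact hd h.1
        · exact hd h.2
    rw [this, totalDegree_C] at hf
    exact zero_ne_one hf
  · intro x
    have h01 : (Finsupp.single 0 1 : Fin 2 →₀ ℕ) ≠ Finsupp.single 1 1 := by
      intro h
      simpa using DFunLike.congr_fun h 0
    rw [eval_eq, Finset.sum_subset hsupp (by
      intro d _ hd
      rw [notMem_support_iff.1 hd, zero_mul])]
    rw [Finset.sum_insert (by simp [eq_comm]), Finset.sum_insert (by simpa using h01),
      Finset.sum_singleton]
    simp
    ring

theorem IsLine.eq_of_mem_s8 {L M : Set Pt} {p q : Pt} (hL : IsLine L) (hM : IsLine M) (hpq : p ≠ q)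
    (hpL : p ∈ L) (hqL : q ∈ L) (hpM : p ∈ M) (hqM : q ∈ M) : L = M := by
  obtain ⟨f, hf, rfl⟩ := hL
  obtain ⟨g, hg, rfl⟩ := hM
  obtain ⟨a, b, c, hab, hf⟩ := exists_eval_eq_of_totalDegree_eq_one hf
  obtain ⟨a', b', c', hab', hg⟩ := exists_eval_eq_of_totalDegree_eq_one hg
  simp only [Set.mem_ofPred_eq, hf, hg] at *
  have hd : p 0 - q 0 ≠ 0 ∨ p 1 - q 1 ≠ 0 := by
    by_contra! h
    apply hpq
    ext i
    fin_cases i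
    · exact sub_eq_zero.1 h.1
    · exact sub_eq_zero.1 h.2
  have hdet : a * b' = a' * b := by
    rcases hd with h | h <;> apply mul_left_cancel₀ h <;> grind
  ext x
  simp only [Set.mem_ofPred_eq]
  constructor <;> intro hx
  · rcases hab with h | h <;> apply mul_left_cancel₀ h <;> grind
  · rcases hab' with h | h <;> apply mul_left_cancel₀ h <;> grind

theorem IsLine.exists_injective {L : Set Pt} (hL : IsLine L) :
    ∃ g : ℕ → Pt, Function.Injective g ∧ ∀ i, g i ∈ L := by
  obtain ⟨f, hf, rfl⟩ := hL
  obtain ⟨a, b, c, hab, hf⟩ := exists_eval_eq_of_totalDegree_eq_one hf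
  have hpos : a ^ 2 + b ^ 2 ≠ 0 := by
    intro h
    rcases hab with h' | h' <;> apply h' <;> nlinarith
  refine ⟨fun i => ![-(a * c) / (a ^ 2 + b ^ 2) + i * b, -(b * c) / (a ^ 2 + b ^ 2) - i * a],
    ?_, ?_⟩
  · intro i j hij
    have h0 := congrFun hij 0
    have h1 := congrFun hij 1
    simp at h0 h1
    grind
  · intro i
    simp only [Set.mem_ofPred_eq, hf, Matrix.cons_val_zero, Matrix.cons_val_one]
    field_simp
    ring

/-- Four distinct points of a line cannot be covered by three other lines. -/
theorem IsLine.eq_of_four_subset_union {L a b c : Set Pt} (hL : IsLine L) (ha : IsLine a)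
    (hb : IsLine b) (hc : IsLine c) (g : Fin 4 → Pt) (hg : Function.Injective g)
    (hgL : ∀ i, g i ∈ L) (hcov : ∀ i, g i ∈ a ∨ g i ∈ b ∨ g i ∈ c) :
    L = a ∨ L = b ∨ L = c := by
  have hcov' : ∀ i, ∃ k : Fin 3, g i ∈ ![a, b, c] k := by
    intro i
    rcases hcov i with h | h | h
    exacts [⟨0, h⟩, ⟨1, h⟩, ⟨2, h⟩]
  choose k hk using hcov'
  obtain ⟨i, j, hij, hkij⟩ := Fintype.exists_ne_map_eq_of_card_lt k (by simp)
  have key : ∀ m, IsLine (![a, b, c] m) → L = ![a, b, c] m ∨ k i ≠ m := by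
    intro m hm
    by_cases h : k i = m
    · left
      exact hL.eq_of_mem_s8 hm (hg.ne hij) (hgL i) (hgL j) (h ▸ hk i) (h ▸ hkij ▸ hk j)
    · exact Or.inr h
  have h0 := key 0 ha
  have h1 := key 1 hb
  have h2 := key 2 hc
  simp only [Matrix.cons_val] at h0 h1 h2
  have : k i = 0 ∨ k i = 1 ∨ k i = 2 := by omega
  tauto

/-- Three distinct points of a line cannot be covered by two other lines. -/
theorem IsLine.eq_of_three_subset_union {L a b : Set Pt} (hL : IsLine L) (ha : IsLine a)
    (hb : IsLine b) {p q r : Pt} (hpq : p ≠ q) (hpr : p ≠ r) (hqr : q ≠ r)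
    (hp : p ∈ L) (hq : q ∈ L) (hr : r ∈ L) (hpc : p ∈ a ∨ p ∈ b) (hqc : q ∈ a ∨ q ∈ b)
    (hrc : r ∈ a ∨ r ∈ b) : L = a ∨ L = b := by
  have ea := fun x y h hx hy => hL.eq_of_mem_s8 (p := x) (q := y) ha h hx hy
  have eb := fun x y h hx hy => hL.eq_of_mem_s8 (p := x) (q := y) hb h hx hy
  grind

/-- The three lines whose product is the fundamental polynomial of a node of a `GC_3` set. -/
theorem IsGC.exists_lines {X : Set Pt} (hX : IsGC 3 X) {A : Pt} (hA : A ∈ X) :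
    ∃ a b c : Set Pt, IsLine a ∧ IsLine b ∧ IsLine c ∧ A ∉ a ∧ A ∉ b ∧ A ∉ c ∧
      (∀ B ∈ X, B ≠ A → B ∈ a ∨ B ∈ b ∨ B ∈ c) ∧
      ∀ L, IsLine L → (Uses 3 X L A ↔ L = a ∨ L = b ∨ L = c) := by
  classical
  obtain ⟨p, hp, f, hf, hpf⟩ := hX.2 A hA
  have hpf' : p = f 0 * f 1 * f 2 := by rw [hpf, Fin.prod_univ_three]
  have hev : ∀ x, eval x p = eval x (f 0) * eval x (f 1) * eval x (f 2) := by
    intro x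
    rw [hpf', map_mul, map_mul]
  have huniq : ∀ q, IsFund 3 X A q → q = p := by
    intro q hq
    refine (hX.1.2 (fun B => if B = A then 1 else 0)).unique ⟨hq.1, ?_⟩ ⟨hp.1, ?_⟩
    · intro B hB
      split_ifs with h
      · rw [h, hq.2.1]
      · exact hq.2.2 B hB h
    · intro B hB
      split_ifs with h
      · rw [h, hp.2.1]
      · exact hp.2.2 B hB h
  have hA1 := hp.2.1
  rw [hev] at hA1
  have hline : ∀ i, IsLine {x : Pt | eval x (f i) = 0} := fun i => ⟨f i, hf i, rfl⟩
  refine ⟨{x | eval x (f 0) = 0}, {x | eval x (f 1) = 0}, {x | eval x (f 2) = 0},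
    hline 0, hline 1, hline 2, ?_, ?_, ?_, ?_, ?_⟩
  · intro h
    simp [show eval A (f 0) = 0 from h] at hA1
  · intro h
    simp [show eval A (f 1) = 0 from h] at hA1
  · intro h
    simp [show eval A (f 2) = 0 from h] at hA1
  · intro B hB hBA
    have h := hp.2.2 B hB hBA
    rw [hev] at h
    simpa [or_assoc] using h
  · intro L hL
    constructor
    · rintro ⟨q, g, hq, -, rfl, r, hr⟩
      rw [huniq q hq] at hr
      obtain ⟨u, hu, huL⟩ := hL.exists_injective
      refine hL.eq_of_four_subset_union (hline 0) (hline 1) (hline 2) (fun i => u i)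
        (fun i j h => Fin.ext (hu h)) (fun i => huL i) ?_
      intro i
      have h := congrArg (eval (u i)) hr
      have h0 : eval (u i) g = 0 := huL i
      rw [hev, map_mul, h0, zero_mul] at h
      simpa [or_assoc] using h
    · have huse : ∀ i, Uses 3 X {x | eval x (f i) = 0} A := fun i =>
        ⟨p, f i, hp, hf i, rfl, hpf ▸ Finset.dvd_prod_of_mem f (Finset.mem_univ i)⟩
      rintro (rfl | rfl | rfl)
      exacts [huse 0, huse 1, huse 2]

theorem IsMaxLine.exists_injective {X M : Set Pt} (hM : IsMaxLine 3 X M) :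
    ∃ g : Fin 4 → Pt, Function.Injective g ∧ ∀ i, g i ∈ X ∧ g i ∈ M := by
  have hcard : Nat.card ↥(X ∩ M) = 4 := hM.2
  have : Finite ↥(X ∩ M) := Nat.finite_of_card_ne_zero (by omega)
  let e := Finite.equivFinOfCardEq hcard
  exact ⟨fun i => (e.symm i : Pt), Subtype.val_injective.comp e.symm.injective,
    fun i => (e.symm i).2⟩

/-- A node outside a maximal line uses it. -/
theorem IsGC.exists_lines_of_notMem {X M : Set Pt} (hX : IsGC 3 X) (hM : IsMaxLine 3 X M)
    {A : Pt} (hA : A ∈ X) (hAM : A ∉ M) :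
    ∃ b c : Set Pt, IsLine b ∧ IsLine c ∧ A ∉ b ∧ A ∉ c ∧
      (∀ B ∈ X, B ≠ A → B ∉ M → B ∈ b ∨ B ∈ c) ∧
      ∀ L, IsLine L → (Uses 3 X L A ↔ L = M ∨ L = b ∨ L = c) := by
  obtain ⟨a, b, c, ha, hb, hc, hAa, hAb, hAc, hcov, huse⟩ := hX.exists_lines hA
  obtain ⟨g, hg, hgM⟩ := hM.exists_injective
  have h := hM.1.eq_of_four_subset_union ha hb hc g hg (fun i => (hgM i).2) fun i =>
    hcov _ (hgM i).1 fun h => hAM (h ▸ (hgM i).2)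
  rcases h with rfl | rfl | rfl
  · exact ⟨b, c, hb, hc, hAb, hAc, fun B hB hBA hBM => by grind, huse⟩
  · exact ⟨a, c, ha, hc, hAa, hAc, fun B hB hBA hBM => by grind, fun L hL => by grind⟩
  · exact ⟨a, b, ha, hb, hAa, hAb, fun B hB hBA hBM => by grind, fun L hL => by grind⟩

/-- A node outside two maximal lines uses both. -/
theorem IsGC.exists_line_of_notMem_of_notMem {X M N : Set Pt} (hX : IsGC 3 X)
    (hM : IsMaxLine 3 X M) (hN : IsMaxLine 3 X N) (hMN : M ≠ N)
    {A : Pt} (hA : A ∈ X) (hAM : A ∉ M) (hAN : A ∉ N) :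
    ∃ c : Set Pt, IsLine c ∧ A ∉ c ∧ (∀ B ∈ X, B ≠ A → B ∉ M → B ∉ N → B ∈ c) ∧
      ∀ L, IsLine L → (Uses 3 X L A ↔ L = M ∨ L = N ∨ L = c) := by
  obtain ⟨b, c, hb, hc, hAb, hAc, hcov, huse⟩ := hX.exists_lines_of_notMem hM hA hAM
  obtain ⟨g, hg, hgN⟩ := hN.exists_injective
  have h := hN.1.eq_of_four_subset_union hM.1 hb hc g hg (fun i => (hgN i).2) fun i => by
    have := hcov _ (hgN i).1 fun h => hAN (h ▸ (hgN i).2)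
    tauto
  rcases h with rfl | rfl | rfl
  · exact absurd rfl hMN
  · exact ⟨c, hc, hAc, fun B hB hBA hBM hBN => by grind, huse⟩
  · exact ⟨b, hb, hAb, fun B hB hBA hBM hBN => by grind, fun L hL => by grind⟩

/-- A node outside three maximal lines uses exactly these lines. -/
theorem IsGC.uses_iff_of_notMem {X M N K : Set Pt} (hX : IsGC 3 X)
    (hM : IsMaxLine 3 X M) (hN : IsMaxLine 3 X N) (hK : IsMaxLine 3 X K)
    (hMN : M ≠ N) (hMK : M ≠ K) (hNK : N ≠ K)
    {A : Pt} (hA : A ∈ X) (hAM : A ∉ M) (hAN : A ∉ N) (hAK : A ∉ K) {L : Set Pt} (hL : IsLine L) :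
    Uses 3 X L A ↔ L = M ∨ L = N ∨ L = K := by
  obtain ⟨c, -, -, -, huse⟩ := hX.exists_line_of_notMem_of_notMem hM hN hMN hA hAM hAN
  obtain ⟨d, -, -, -, huse'⟩ := hX.exists_line_of_notMem_of_notMem hM hK hMK hA hAM hAK
  have h := (huse K hK.1).1 ((huse' K hK.1).2 (Or.inr (Or.inl rfl)))
  rw [huse L hL]
  grind

theorem IsGC.exists_mem_of_isMaxLine {X M N : Set Pt} (hX : IsGC 3 X)
    (hM : IsMaxLine 3 X M) (hN : IsMaxLine 3 X N) : ∃ V ∈ X, V ∈ M ∧ V ∈ N := by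
  by_contra! hno
  obtain ⟨g, hg, hgM⟩ := hM.exists_injective
  have hgN : ∀ i, g i ∉ N := fun i => hno _ (hgM i).1 (hgM i).2
  obtain ⟨b, c, hb, hc, hAb, hAc, hcov, -⟩ :=
    hX.exists_lines_of_notMem hN (hgM 0).1 (hgN 0)
  have hcov' : ∀ i, i ≠ 0 → g i ∈ b ∨ g i ∈ c := fun i hi =>
    hcov _ (hgM i).1 (hg.ne hi) (hgN i)
  rcases hM.1.eq_of_three_subset_union hb hc (hg.ne (show (1 : Fin 4) ≠ 2 by decide))
    (hg.ne (show (1 : Fin 4) ≠ 3 by decide)) (hg.ne (show (2 : Fin 4) ≠ 3 by decide))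
    (hgM 1).2 (hgM 2).2 (hgM 3).2 (hcov' 1 (by decide)) (hcov' 2 (by decide))
    (hcov' 3 (by decide)) with rfl | rfl
  exacts [hAb (hgM 0).2, hAc (hgM 0).2]

theorem IsGC.not_concurrent {X M N K : Set Pt} (hX : IsGC 3 X)
    (hM : IsMaxLine 3 X M) (hN : IsMaxLine 3 X N) (hK : IsMaxLine 3 X K)
    (hMN : M ≠ N) (hMK : M ≠ K) (hNK : N ≠ K) {V : Pt} (hV : V ∈ X)
    (hVM : V ∈ M) (hVN : V ∈ N) : V ∉ K := by
  intro hVK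
  have hcard : ((X ∩ M) \ {V}).ncard = 3 := by
    rw [Set.ncard_sdiff_singleton_of_mem (show V ∈ X ∩ M from ⟨hV, hVM⟩), hM.2]
  obtain ⟨p, q, r, hpq, hpr, hqr, hset⟩ := Set.ncard_eq_three.1 hcard
  have hmem : ∀ x, ((x ∈ X ∧ x ∈ M) ∧ x ≠ V) ↔ x = p ∨ x = q ∨ x = r := fun x => by
    simpa using Set.ext_iff.1 hset x
  have hp := (hmem p).2 (by simp)
  have hq := (hmem q).2 (by simp)
  have hr := (hmem r).2 (by simp)
  have hout : ∀ x, x ∈ M → x ≠ V → x ∉ N ∧ x ∉ K := fun x hx hxV =>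
    ⟨fun h => hMN (hM.1.eq_of_mem_s8 hN.1 hxV hx hVM h hVN),
      fun h => hMK (hM.1.eq_of_mem_s8 hK.1 hxV hx hVM h hVK)⟩
  have hop := hout p hp.1.2 hp.2
  have hoq := hout q hq.1.2 hq.2
  have hor := hout r hr.1.2 hr.2
  obtain ⟨c, hc, hpc, hcov, -⟩ :=
    hX.exists_line_of_notMem_of_notMem hN hK hNK hp.1.1 hop.1 hop.2
  have := hM.1.eq_of_mem_s8 hc hqr hq.1.2 hr.1.2 (hcov q hq.1.1 hpq.symm hoq.1 hoq.2)
    (hcov r hr.1.1 hpr.symm hor.1 hor.2)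
  exact hpc (this ▸ hp.1.2)

theorem IsMaxLine.exists_pair {X M : Set Pt} (hM : IsMaxLine 3 X M) {V W : Pt} (hVW : V ≠ W)
    (hV : V ∈ X) (hW : W ∈ X) (hVM : V ∈ M) (hWM : W ∈ M) :
    ∃ p q, p ≠ q ∧ p ≠ V ∧ p ≠ W ∧ q ≠ V ∧ q ≠ W ∧
      ∀ x, x ∈ X ∧ x ∈ M ↔ x = V ∨ x = W ∨ x = p ∨ x = q := by
  have hcard : (((X ∩ M) \ {V}) \ {W}).ncard = 2 := by
    rw [Set.ncard_sdiff_singleton_of_mem (show W ∈ (X ∩ M) \ {V} from ⟨⟨hW, hWM⟩, hVW.symm⟩),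
      Set.ncard_sdiff_singleton_of_mem (show V ∈ X ∩ M from ⟨hV, hVM⟩), hM.2]
  obtain ⟨p, q, hpq, hset⟩ := Set.ncard_eq_two.1 hcard
  have hmem : ∀ x, (((x ∈ X ∧ x ∈ M) ∧ x ≠ V) ∧ x ≠ W) ↔ x = p ∨ x = q := fun x => by
    simpa using Set.ext_iff.1 hset x
  have hp := (hmem p).2 (by simp)
  have hq := (hmem q).2 (by simp)
  refine ⟨p, q, hpq, hp.1.2, hp.2, hq.1.2, hq.2, fun x => ?_⟩
  have := hmem x
  constructor
  · intro hx
    tauto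
  · rintro (rfl | rfl | h | h) <;> tauto

/-- The fundamental polynomial of the vertex `V` of two maximal lines `M`, `N` not lying on a third
maximal line `K`. -/
theorem IsGC.exists_lines_of_vertex {X M N K : Set Pt} (hX : IsGC 3 X)
    (hM : IsLine M) (hN : IsLine N) (hK : IsMaxLine 3 X K)
    {V O p q r s : Pt} (hV : V ∈ X) (hVM : V ∈ M) (hVN : V ∈ N) (hVK : V ∉ K)
    (hO : O ∈ X) (hOM : O ∉ M) (hOK : O ∉ K) (hpq : p ≠ q) (hrs : r ≠ s)
    (hp : (p ∈ X ∧ p ∈ M) ∧ p ≠ V ∧ p ∉ K) (hq : (q ∈ X ∧ q ∈ M) ∧ q ≠ V ∧ q ∉ K)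
    (hr : (r ∈ X ∧ r ∈ N) ∧ r ≠ V ∧ r ∉ K) (hs : (s ∈ X ∧ s ∈ N) ∧ s ≠ V ∧ s ∉ K) :
    ∃ p' q' r' s' : Pt, ∃ L S : Set Pt,
      (p' = p ∧ q' = q ∨ p' = q ∧ q' = p) ∧ (r' = r ∧ s' = s ∨ r' = s ∧ s' = r) ∧
      IsLine L ∧ IsLine S ∧ V ∉ L ∧ V ∉ S ∧ (O ∈ L ∧ p' ∈ L ∧ r' ∈ L) ∧ (q' ∈ S ∧ s' ∈ S) ∧
      ∀ ℓ, IsLine ℓ → (Uses 3 X ℓ V ↔ ℓ = K ∨ ℓ = L ∨ ℓ = S) := by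
  obtain ⟨b, c, hb, hc, hVb, hVc, hcov, huse⟩ := hX.exists_lines_of_notMem hK hV hVK
  have key : ∀ b c : Set Pt, IsLine b → IsLine c → V ∉ b → V ∉ c → O ∈ b →
      (∀ B ∈ X, B ≠ V → B ∉ K → B ∈ b ∨ B ∈ c) →
      (∃ p' q', (p' = p ∧ q' = q ∨ p' = q ∧ q' = p) ∧ p' ∈ b ∧ q' ∈ c) ∧
      (∃ r' s', (r' = r ∧ s' = s ∨ r' = s ∧ s' = r) ∧ r' ∈ b ∧ s' ∈ c) := by
    intro b c hb hc hVb hVc hOb hcov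
    have aux : ∀ M : Set Pt, IsLine M → V ∈ M → ∀ p q : Pt, p ≠ q →
        (p ∈ X ∧ p ∈ M) ∧ p ≠ V ∧ p ∉ K → (q ∈ X ∧ q ∈ M) ∧ q ≠ V ∧ q ∉ K →
        ∃ p' q', (p' = p ∧ q' = q ∨ p' = q ∧ q' = p) ∧ p' ∈ b ∧ q' ∈ c := by
      intro M hM hVM p q hpq hp hq
      have hnb : ¬(p ∈ b ∧ q ∈ b) := fun h =>
        hVb (hM.eq_of_mem_s8 hb hpq hp.1.2 hq.1.2 h.1 h.2 ▸ hVM)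
      have hnc : ¬(p ∈ c ∧ q ∈ c) := fun h =>
        hVc (hM.eq_of_mem_s8 hc hpq hp.1.2 hq.1.2 h.1 h.2 ▸ hVM)
      have h1 := hcov p hp.1.1 hp.2.1 hp.2.2
      have h2 := hcov q hq.1.1 hq.2.1 hq.2.2
      by_cases h : p ∈ b
      · exact ⟨p, q, by simp, h, by tauto⟩
      · exact ⟨q, p, by simp, by tauto, by tauto⟩
    exact ⟨aux M hM hVM p q hpq hp hq, aux N hN hVN r s hrs hr hs⟩
  rcases hcov O hO (fun h => hOM (h ▸ hVM)) hOK with hOb | hOc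
  · obtain ⟨⟨p', q', hpq', hpb, hqc⟩, r', s', hrs', hrb, hsc⟩ := key b c hb hc hVb hVc hOb hcov
    exact ⟨p', q', r', s', b, c, hpq', hrs', hb, hc, hVb, hVc, ⟨hOb, hpb, hrb⟩, ⟨hqc, hsc⟩, huse⟩
  · obtain ⟨⟨p', q', hpq', hpb, hqc⟩, r', s', hrs', hrb, hsc⟩ := key c b hc hb hVc hVb hOc
      fun B hB h1 h2 => (hcov B hB h1 h2).symm
    exact ⟨p', q', r', s', c, b, hpq', hrs', hc, hb, hVc, hVb, ⟨hOc, hpb, hrb⟩, ⟨hqc, hsc⟩,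
      fun ℓ hℓ => by rw [huse ℓ hℓ, or_comm (a := ℓ = b)]⟩

/-- A line through the node `O` outside three maximal lines covering the other nodes, and through a
node on each of these, is itself a maximal line. -/
theorem IsLine.isMaxLine_of_mem {X M N K L : Set Pt} (hL : IsLine L) (hM : IsLine M)
    (hN : IsLine N) (hK : IsLine K) {O x y z : Pt} (hcov : ∀ w ∈ X, w = O ∨ w ∈ M ∨ w ∈ N ∨ w ∈ K)
    (hO : O ∈ X) (hOM : O ∉ M) (hON : O ∉ N) (hOK : O ∉ K) (hOL : O ∈ L)
    (hx : x ∈ X ∧ x ∈ M ∧ x ∉ N) (hy : y ∈ X ∧ y ∈ N ∧ y ∉ K) (hz : z ∈ X ∧ z ∈ K ∧ z ∉ M)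
    (hxL : x ∈ L) (hyL : y ∈ L) (hzL : z ∈ L) : IsMaxLine 3 X L := by
  have hone : ∀ M : Set Pt, IsLine M → O ∉ M → ∀ v w, v ∈ M → w ∈ M → v ∈ L → w ∈ L → w = v := by
    intro M hM hOM v w hv hw hvL hwL
    by_contra h
    exact hOM (hL.eq_of_mem_s8 hM h hwL hvL hw hv ▸ hOL)
  have hset : X ∩ L = {O, x, y, z} := by
    ext w
    simp only [Set.mem_inter_iff, Set.mem_insert_iff, Set.mem_singleton_iff]
    constructor
    · rintro ⟨hwX, hwL⟩
      rcases hcov w hwX with h | h | h | h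
      · exact Or.inl h
      · exact Or.inr (Or.inl (hone M hM hOM x w hx.2.1 h hxL hwL))
      · exact Or.inr (Or.inr (Or.inl (hone N hN hON y w hy.2.1 h hyL hwL)))
      · exact Or.inr (Or.inr (Or.inr (hone K hK hOK z w hz.2.1 h hzL hwL)))
    · rintro (rfl | rfl | rfl | rfl)
      exacts [⟨hO, hOL⟩, ⟨hx.1, hxL⟩, ⟨hy.1, hyL⟩, ⟨hz.1, hzL⟩]
  refine ⟨hL, ?_⟩
  rw [hset, Set.ncard_insert_of_notMem, Set.ncard_insert_of_notMem, Set.ncard_pair]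
  · rintro rfl
    exact hy.2.2 hz.2.1
  · rintro (rfl | rfl)
    exacts [hx.2.2 hy.2.1, hz.2.2 hx.2.1]
  · rintro (rfl | rfl | rfl)
    exacts [hOM hx.2.1, hON hy.2.1, hOK hz.2.1]

/-- The incidences in a `GC_3` set with exactly three maximal lines `M`, `N`, `K`: the vertices are
`V`, `W`, `U`, the other nodes on the maximal lines are `P₁, Q₁ ∈ M`, `P₂, Q₂ ∈ N`, `P₃, Q₃ ∈ K`,
and `O` is the remaining node. -/
structure TriangleConfig (X M N K : Set Pt) (V W U O P₁ Q₁ P₂ Q₂ P₃ Q₃ : Pt)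
    (L₁ L₂ L₃ S₁ S₂ S₃ : Set Pt) : Prop where
  isMaxLine_M : IsMaxLine 3 X M
  isMaxLine_N : IsMaxLine 3 X N
  isMaxLine_K : IsMaxLine 3 X K
  mem_X : ∀ x, x ∈ X ↔ x = O ∨ (x = U ∨ x = V ∨ x = P₁ ∨ x = Q₁) ∨
    (x = V ∨ x = W ∨ x = P₂ ∨ x = Q₂) ∨ (x = W ∨ x = U ∨ x = P₃ ∨ x = Q₃)
  O_notMem : O ∉ M ∧ O ∉ N ∧ O ∉ K
  V_mem : V ∈ M ∧ V ∈ N ∧ V ∉ K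
  W_mem : W ∈ N ∧ W ∈ K ∧ W ∉ M
  U_mem : U ∈ K ∧ U ∈ M ∧ U ∉ N
  P₁_mem : P₁ ∈ M ∧ P₁ ∉ N ∧ P₁ ∉ K
  Q₁_mem : Q₁ ∈ M ∧ Q₁ ∉ N ∧ Q₁ ∉ K
  P₂_mem : P₂ ∈ N ∧ P₂ ∉ K ∧ P₂ ∉ M
  Q₂_mem : Q₂ ∈ N ∧ Q₂ ∉ K ∧ Q₂ ∉ M
  P₃_mem : P₃ ∈ K ∧ P₃ ∉ M ∧ P₃ ∉ N
  Q₃_mem : Q₃ ∈ K ∧ Q₃ ∉ M ∧ Q₃ ∉ N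
  P₁_ne_Q₁ : P₁ ≠ Q₁
  P₂_ne_Q₂ : P₂ ≠ Q₂
  P₃_ne_Q₃ : P₃ ≠ Q₃
  isLine_L₁ : IsLine L₁
  isLine_L₂ : IsLine L₂
  isLine_L₃ : IsLine L₃
  isLine_S₁ : IsLine S₁
  isLine_S₂ : IsLine S₂
  isLine_S₃ : IsLine S₃
  mem_L₁ : O ∈ L₁ ∧ P₁ ∈ L₁ ∧ Q₂ ∈ L₁
  mem_L₂ : O ∈ L₂ ∧ P₂ ∈ L₂ ∧ Q₃ ∈ L₂
  mem_L₃ : O ∈ L₃ ∧ P₃ ∈ L₃ ∧ Q₁ ∈ L₃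
  mem_S₁ : Q₁ ∈ S₁ ∧ P₂ ∈ S₁ ∧ V ∉ S₁
  mem_S₂ : Q₂ ∈ S₂ ∧ P₃ ∈ S₂ ∧ W ∉ S₂
  mem_S₃ : Q₃ ∈ S₃ ∧ P₁ ∈ S₃ ∧ U ∉ S₃
  not_transversal : ∀ L x y z, IsLine L → O ∈ L → x ∈ L → y ∈ L → z ∈ L →
    x = P₁ ∨ x = Q₁ → y = P₂ ∨ y = Q₂ → z = P₃ ∨ z = Q₃ → False
  uses_O : ∀ ℓ, IsLine ℓ → (Uses 3 X ℓ O ↔ ℓ = M ∨ ℓ = N ∨ ℓ = K)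
  uses_V : ∀ ℓ, IsLine ℓ → (Uses 3 X ℓ V ↔ ℓ = K ∨ ℓ = L₁ ∨ ℓ = S₁)
  uses_W : ∀ ℓ, IsLine ℓ → (Uses 3 X ℓ W ↔ ℓ = M ∨ ℓ = L₂ ∨ ℓ = S₂)
  uses_U : ∀ ℓ, IsLine ℓ → (Uses 3 X ℓ U ↔ ℓ = N ∨ ℓ = L₃ ∨ ℓ = S₃)
  uses_P₁ : ∀ ℓ, IsLine ℓ → (Uses 3 X ℓ P₁ ↔ ℓ = N ∨ ℓ = K ∨ ℓ = L₃)
  uses_Q₁ : ∀ ℓ, IsLine ℓ → (Uses 3 X ℓ Q₁ ↔ ℓ = N ∨ ℓ = K ∨ ℓ = L₁)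
  uses_P₂ : ∀ ℓ, IsLine ℓ → (Uses 3 X ℓ P₂ ↔ ℓ = K ∨ ℓ = M ∨ ℓ = L₁)
  uses_Q₂ : ∀ ℓ, IsLine ℓ → (Uses 3 X ℓ Q₂ ↔ ℓ = K ∨ ℓ = M ∨ ℓ = L₂)
  uses_P₃ : ∀ ℓ, IsLine ℓ → (Uses 3 X ℓ P₃ ↔ ℓ = M ∨ ℓ = N ∨ ℓ = L₂)
  uses_Q₃ : ∀ ℓ, IsLine ℓ → (Uses 3 X ℓ Q₃ ↔ ℓ = M ∨ ℓ = N ∨ ℓ = L₃)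

namespace TriangleConfig

variable {X M N K : Set Pt} {V W U O P₁ Q₁ P₂ Q₂ P₃ Q₃ : Pt} {L₁ L₂ L₃ S₁ S₂ S₃ : Set Pt}

theorem rotate (h : TriangleConfig X M N K V W U O P₁ Q₁ P₂ Q₂ P₃ Q₃ L₁ L₂ L₃ S₁ S₂ S₃) :
    TriangleConfig X N K M W U V O P₂ Q₂ P₃ Q₃ P₁ Q₁ L₂ L₃ L₁ S₂ S₃ S₁ where
  isMaxLine_M := h.isMaxLine_N
  isMaxLine_N := h.isMaxLine_K
  isMaxLine_K := h.isMaxLine_M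
  mem_X x := by rw [h.mem_X]; tauto
  O_notMem := ⟨h.O_notMem.2.1, h.O_notMem.2.2, h.O_notMem.1⟩
  V_mem := h.W_mem
  W_mem := h.U_mem
  U_mem := h.V_mem
  P₁_mem := h.P₂_mem
  Q₁_mem := h.Q₂_mem
  P₂_mem := h.P₃_mem
  Q₂_mem := h.Q₃_mem
  P₃_mem := h.P₁_mem
  Q₃_mem := h.Q₁_mem
  P₁_ne_Q₁ := h.P₂_ne_Q₂
  P₂_ne_Q₂ := h.P₃_ne_Q₃
  P₃_ne_Q₃ := h.P₁_ne_Q₁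
  isLine_L₁ := h.isLine_L₂
  isLine_L₂ := h.isLine_L₃
  isLine_L₃ := h.isLine_L₁
  isLine_S₁ := h.isLine_S₂
  isLine_S₂ := h.isLine_S₃
  isLine_S₃ := h.isLine_S₁
  mem_L₁ := h.mem_L₂
  mem_L₂ := h.mem_L₃
  mem_L₃ := h.mem_L₁
  mem_S₁ := h.mem_S₂
  mem_S₂ := h.mem_S₃
  mem_S₃ := h.mem_S₁
  not_transversal L x y z hL hO hx hy hz h1 h2 h3 :=
    h.not_transversal L z x y hL hO hz hx hy h3 h1 h2
  uses_O ℓ hℓ := by rw [h.uses_O ℓ hℓ]; tauto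
  uses_V := h.uses_W
  uses_W := h.uses_U
  uses_U := h.uses_V
  uses_P₁ := h.uses_P₂
  uses_Q₁ := h.uses_Q₂
  uses_P₂ := h.uses_P₃
  uses_Q₂ := h.uses_Q₃
  uses_P₃ ℓ hℓ := by rw [h.uses_P₁ ℓ hℓ]
  uses_Q₃ ℓ hℓ := by rw [h.uses_Q₁ ℓ hℓ]

theorem ncard_S₁_le (h : TriangleConfig X M N K V W U O P₁ Q₁ P₂ Q₂ P₃ Q₃ L₁ L₂ L₃ S₁ S₂ S₃) :
    (X ∩ S₁).ncard ≤ 2 := by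
  have hO : O ∉ S₁ := fun hO => by
    have hOQ : O ≠ Q₁ := fun e => h.O_notMem.1 (e ▸ h.Q₁_mem.1)
    have e := h.isLine_S₁.eq_of_mem_s8 h.isLine_L₃ hOQ hO h.mem_S₁.1 h.mem_L₃.1 h.mem_L₃.2.2
    exact h.not_transversal S₁ Q₁ P₂ P₃ h.isLine_S₁ hO h.mem_S₁.1 h.mem_S₁.2.1
      (e ▸ h.mem_L₃.2.1) (by simp) (by simp) (by simp)
  have hP₃ : P₃ ∉ S₁ := fun hP => by
    have hne : P₃ ≠ Q₁ := fun e => h.Q₁_mem.2.2 (e ▸ h.P₃_mem.1)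
    have e := h.isLine_S₁.eq_of_mem_s8 h.isLine_L₃ hne hP h.mem_S₁.1 h.mem_L₃.2.1 h.mem_L₃.2.2
    exact hO (e ▸ h.mem_L₃.1)
  have hQ₃ : Q₃ ∉ S₁ := fun hP => by
    have hne : Q₃ ≠ P₂ := fun e => h.P₂_mem.2.1 (e ▸ h.Q₃_mem.1)
    have e := h.isLine_S₁.eq_of_mem_s8 h.isLine_L₂ hne hP h.mem_S₁.2.1 h.mem_L₂.2.2 h.mem_L₂.2.1
    exact hO (e ▸ h.mem_L₂.1)
  have hM : ∀ x, x ∈ M → x ∈ S₁ → x = Q₁ := fun x hx hxS => by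
    by_contra hne
    have e := h.isLine_S₁.eq_of_mem_s8 h.isMaxLine_M.1 hne hxS h.mem_S₁.1 hx h.Q₁_mem.1
    exact h.mem_S₁.2.2 (e ▸ h.V_mem.1)
  have hN : ∀ x, x ∈ N → x ∈ S₁ → x = P₂ := fun x hx hxS => by
    by_contra hne
    have e := h.isLine_S₁.eq_of_mem_s8 h.isMaxLine_N.1 hne hxS h.mem_S₁.2.1 hx h.P₂_mem.1
    exact h.mem_S₁.2.2 (e ▸ h.V_mem.2.1)
  have hsub : X ∩ S₁ ⊆ {Q₁, P₂} := by
    rintro x ⟨hxX, hxS⟩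
    simp only [Set.mem_insert_iff, Set.mem_singleton_iff]
    rcases (h.mem_X x).1 hxX with rfl | (rfl | rfl | rfl | rfl) | (rfl | rfl | rfl | rfl) |
      (rfl | rfl | rfl | rfl)
    · exact absurd hxS hO
    · exact Or.inl (hM _ h.U_mem.2.1 hxS)
    · exact Or.inl (hM _ h.V_mem.1 hxS)
    · exact Or.inl (hM _ h.P₁_mem.1 hxS)
    · exact Or.inl rfl
    · exact Or.inl (hM _ h.V_mem.1 hxS)
    · exact Or.inr (hN _ h.W_mem.1 hxS)
    · exact Or.inr rfl
    · exact Or.inr (hN _ h.Q₂_mem.1 hxS)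
    · exact Or.inr (hN _ h.W_mem.1 hxS)
    · exact Or.inl (hM _ h.U_mem.2.1 hxS)
    · exact absurd hxS hP₃
    · exact absurd hxS hQ₃
  exact (Set.ncard_le_ncard hsub).trans ((Set.ncard_insert_le _ _).trans (by rw [Set.ncard_singleton]))

theorem L₁_ne_L₂ (h : TriangleConfig X M N K V W U O P₁ Q₁ P₂ Q₂ P₃ Q₃ L₁ L₂ L₃ S₁ S₂ S₃) :
    L₁ ≠ L₂ := fun e =>
  h.not_transversal L₁ P₁ Q₂ Q₃ h.isLine_L₁ h.mem_L₁.1 h.mem_L₁.2.1 h.mem_L₁.2.2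
    (e ▸ h.mem_L₂.2.2) (by simp) (by simp) (by simp)

theorem useSet_L₁ (h : TriangleConfig X M N K V W U O P₁ Q₁ P₂ Q₂ P₃ Q₃ L₁ L₂ L₃ S₁ S₂ S₃)
    (hL₁ : (X ∩ L₁).ncard = 3) : (UseSet 3 X L₁).ncard = 3 := by
  have hM : L₁ ≠ M := fun e => h.O_notMem.1 (e ▸ h.mem_L₁.1)
  have hN : L₁ ≠ N := fun e => h.O_notMem.2.1 (e ▸ h.mem_L₁.1)
  have hK : L₁ ≠ K := fun e => h.O_notMem.2.2 (e ▸ h.mem_L₁.1)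
  have h2 : L₁ ≠ L₂ := h.L₁_ne_L₂
  have h3 : L₁ ≠ L₃ := h.rotate.rotate.L₁_ne_L₂.symm
  have hS : L₁ ≠ S₂ ∧ L₁ ≠ S₃ := by
    have := h.rotate.ncard_S₁_le
    have := h.rotate.rotate.ncard_S₁_le
    constructor <;> rintro rfl <;> omega
  have hset : UseSet 3 X L₁ = {V, Q₁, P₂} := by
    ext x
    simp only [UseSet, Set.mem_ofPred_eq, Set.mem_insert_iff, Set.mem_singleton_iff]
    constructor
    · rintro ⟨hxX, hx⟩
      have hO : ¬Uses 3 X L₁ O := by simp [h.uses_O L₁ h.isLine_L₁, hM, hN, hK]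
      have hW : ¬Uses 3 X L₁ W := by simp [h.uses_W L₁ h.isLine_L₁, hM, h2, hS]
      have hU : ¬Uses 3 X L₁ U := by simp [h.uses_U L₁ h.isLine_L₁, hN, h3, hS]
      have hP₁ : ¬Uses 3 X L₁ P₁ := by simp [h.uses_P₁ L₁ h.isLine_L₁, hN, hK, h3]
      have hQ₂ : ¬Uses 3 X L₁ Q₂ := by simp [h.uses_Q₂ L₁ h.isLine_L₁, hM, hK, h2]
      have hP₃ : ¬Uses 3 X L₁ P₃ := by simp [h.uses_P₃ L₁ h.isLine_L₁, hM, hN, h2]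
      have hQ₃ : ¬Uses 3 X L₁ Q₃ := by simp [h.uses_Q₃ L₁ h.isLine_L₁, hM, hN, h3]
      rcases (h.mem_X x).1 hxX with rfl | (rfl | rfl | rfl | rfl) | (rfl | rfl | rfl | rfl) |
        (rfl | rfl | rfl | rfl) <;> first | contradiction | simp
    · have hV := (h.uses_V L₁ h.isLine_L₁).2 (by simp)
      have hQ₁ := (h.uses_Q₁ L₁ h.isLine_L₁).2 (by simp)
      have hP₂ := (h.uses_P₂ L₁ h.isLine_L₁).2 (by simp)
      rintro (rfl | rfl | rfl)
      · exact ⟨(h.mem_X _).2 (by simp), hV⟩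
      · exact ⟨(h.mem_X _).2 (by simp), hQ₁⟩
      · exact ⟨(h.mem_X _).2 (by simp), hP₂⟩
  rw [hset]
  refine Set.ncard_eq_three.2 ⟨V, Q₁, P₂, ?_, ?_, ?_, rfl⟩
  · rintro rfl
    exact h.Q₁_mem.2.1 h.V_mem.2.1
  · rintro rfl
    exact h.P₂_mem.2.2 h.V_mem.1
  · rintro rfl
    exact h.P₂_mem.2.2 h.Q₁_mem.1

theorem ncard_useSet (h : TriangleConfig X M N K V W U O P₁ Q₁ P₂ Q₂ P₃ Q₃ L₁ L₂ L₃ S₁ S₂ S₃)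
    {ℓ : Set Pt} (hℓ : IsNodeLine 3 X ℓ) :
    (UseSet 3 X ℓ).ncard = 3 ∨ (UseSet 3 X ℓ).ncard = 0 := by
  obtain hempty | ⟨x, hxX, hx⟩ := (UseSet 3 X ℓ).eq_empty_or_nonempty
  · right
    rw [hempty, Set.ncard_empty]
  left
  obtain ⟨hline, hcard⟩ := hℓ
  have hmain : ℓ = M ∨ ℓ = N ∨ ℓ = K ∨ ℓ = L₁ ∨ ℓ = L₂ ∨ ℓ = L₃ ∨ ℓ = S₁ ∨ ℓ = S₂ ∨ ℓ = S₃ := by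
    rcases (h.mem_X x).1 hxX with rfl | (rfl | rfl | rfl | rfl) | (rfl | rfl | rfl | rfl) |
      (rfl | rfl | rfl | rfl)
    · rcases (h.uses_O ℓ hline).1 hx with e | e | e <;> simp [e]
    · rcases (h.uses_U ℓ hline).1 hx with e | e | e <;> simp [e]
    · rcases (h.uses_V ℓ hline).1 hx with e | e | e <;> simp [e]
    · rcases (h.uses_P₁ ℓ hline).1 hx with e | e | e <;> simp [e]
    · rcases (h.uses_Q₁ ℓ hline).1 hx with e | e | e <;> simp [e]
    · rcases (h.uses_V ℓ hline).1 hx with e | e | e <;> simp [e]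
    · rcases (h.uses_W ℓ hline).1 hx with e | e | e <;> simp [e]
    · rcases (h.uses_P₂ ℓ hline).1 hx with e | e | e <;> simp [e]
    · rcases (h.uses_Q₂ ℓ hline).1 hx with e | e | e <;> simp [e]
    · rcases (h.uses_W ℓ hline).1 hx with e | e | e <;> simp [e]
    · rcases (h.uses_U ℓ hline).1 hx with e | e | e <;> simp [e]
    · rcases (h.uses_P₃ ℓ hline).1 hx with e | e | e <;> simp [e]
    · rcases (h.uses_Q₃ ℓ hline).1 hx with e | e | e <;> simp [e]
  have hS₁ := h.ncard_S₁_le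
  have hS₂ := h.rotate.ncard_S₁_le
  have hS₃ := h.rotate.rotate.ncard_S₁_le
  have hM := h.isMaxLine_M.2
  have hN := h.isMaxLine_N.2
  have hK := h.isMaxLine_K.2
  rcases hmain with rfl | rfl | rfl | rfl | rfl | rfl | rfl | rfl | rfl
  · omega
  · omega
  · omega
  · exact h.useSet_L₁ hcard
  · exact h.rotate.useSet_L₁ hcard
  · exact h.rotate.rotate.useSet_L₁ hcard
  · omega
  · omega
  · omega

end TriangleConfig

theorem ne_of_relabel {α : Type*} {a b p q : α} (h : p = a ∧ q = b ∨ p = b ∧ q = a)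
    (hab : a ≠ b) : p ≠ q := by
  grind

theorem or_iff_of_relabel {α : Type*} {a b p q : α} (h : p = a ∧ q = b ∨ p = b ∧ q = a) (x : α) :
    x = p ∨ x = q ↔ x = a ∨ x = b := by
  grind

theorem eq_and_eq_of_relabel {α : Type*} {a b p q c d : α} (h : p = a ∧ q = b ∨ p = b ∧ q = a)
    (h' : c = a ∧ d = b ∨ c = b ∧ d = a) (hne : c ≠ q) : c = p ∧ d = q := by
  grind

/-- A `GC_3` set with exactly three maximal lines carries the incidences of a `TriangleConfig`. -/
theorem IsGC.exists_triangleConfig {X : Set Pt} (hX : IsGC 3 X)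
    (hmax : {M : Set Pt | IsMaxLine 3 X M}.ncard = 3) :
    ∃ M N K V W U O P₁ Q₁ P₂ Q₂ P₃ Q₃ L₁ L₂ L₃ S₁ S₂ S₃,
      TriangleConfig X M N K V W U O P₁ Q₁ P₂ Q₂ P₃ Q₃ L₁ L₂ L₃ S₁ S₂ S₃ := by
  obtain ⟨M, N, K, hMN, hMK, hNK, hset⟩ := Set.ncard_eq_three.1 hmax
  have hmaxiff : ∀ L, IsMaxLine 3 X L ↔ L = M ∨ L = N ∨ L = K := fun L => by
    simpa using Set.ext_iff.1 hset L
  have hM := (hmaxiff M).2 (by simp)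
  have hN := (hmaxiff N).2 (by simp)
  have hK := (hmaxiff K).2 (by simp)
  obtain ⟨V, hVX, hVM, hVN⟩ := hX.exists_mem_of_isMaxLine hM hN
  obtain ⟨W, hWX, hWN, hWK⟩ := hX.exists_mem_of_isMaxLine hN hK
  obtain ⟨U, hUX, hUK, hUM⟩ := hX.exists_mem_of_isMaxLine hK hM
  have hVK := hX.not_concurrent hM hN hK hMN hMK hNK hVX hVM hVN
  have hWM := hX.not_concurrent hN hK hM hNK hMN.symm hMK.symm hWX hWN hWK
  have hUN := hX.not_concurrent hK hM hN hMK.symm hNK.symm hMN hUX hUK hUM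
  have eV : ∀ x, x ∈ M → x ∈ N → x = V := fun x hxM hxN => by
    by_contra h
    exact hMN (hM.1.eq_of_mem_s8 hN.1 h hxM hVM hxN hVN)
  have eW : ∀ x, x ∈ N → x ∈ K → x = W := fun x hxN hxK => by
    by_contra h
    exact hNK (hN.1.eq_of_mem_s8 hK.1 h hxN hWN hxK hWK)
  have eU : ∀ x, x ∈ K → x ∈ M → x = U := fun x hxK hxM => by
    by_contra h
    exact hMK.symm (hK.1.eq_of_mem_s8 hM.1 h hxK hUK hxM hUM)
  have hUV : U ≠ V := fun e => hUN (e ▸ hVN)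
  have hVW : V ≠ W := fun e => hVK (e ▸ hWK)
  have hWU : W ≠ U := fun e => hWM (e ▸ hUM)
  obtain ⟨a₁, b₁, hab₁, ha₁U, ha₁V, hb₁U, hb₁V, hXM⟩ :=
    hM.exists_pair hUV hUX hVX hUM hVM
  obtain ⟨a₂, b₂, hab₂, ha₂V, ha₂W, hb₂V, hb₂W, hXN⟩ :=
    hN.exists_pair hVW hVX hWX hVN hWN
  obtain ⟨a₃, b₃, hab₃, ha₃W, ha₃U, hb₃W, hb₃U, hXK⟩ :=
    hK.exists_pair hWU hWX hUX hWK hUK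
  have ha₁ := (hXM a₁).2 (by simp)
  have hb₁ := (hXM b₁).2 (by simp)
  have ha₂ := (hXN a₂).2 (by simp)
  have hb₂ := (hXN b₂).2 (by simp)
  have ha₃ := (hXK a₃).2 (by simp)
  have hb₃ := (hXK b₃).2 (by simp)
  have ha₁NK : a₁ ∉ N ∧ a₁ ∉ K := ⟨fun h => ha₁V (eV _ ha₁.2 h), fun h => ha₁U (eU _ h ha₁.2)⟩
  have hb₁NK : b₁ ∉ N ∧ b₁ ∉ K := ⟨fun h => hb₁V (eV _ hb₁.2 h), fun h => hb₁U (eU _ h hb₁.2)⟩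
  have ha₂KM : a₂ ∉ K ∧ a₂ ∉ M := ⟨fun h => ha₂W (eW _ ha₂.2 h), fun h => ha₂V (eV _ h ha₂.2)⟩
  have hb₂KM : b₂ ∉ K ∧ b₂ ∉ M := ⟨fun h => hb₂W (eW _ hb₂.2 h), fun h => hb₂V (eV _ h hb₂.2)⟩
  have ha₃MN : a₃ ∉ M ∧ a₃ ∉ N := ⟨fun h => ha₃U (eU _ ha₃.2 h), fun h => ha₃W (eW _ h ha₃.2)⟩
  have hb₃MN : b₃ ∉ M ∧ b₃ ∉ N := ⟨fun h => hb₃U (eU _ hb₃.2 h), fun h => hb₃W (eW _ h hb₃.2)⟩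
  -- The union of the three lines contains nine nodes, so one node is left.
  have hcard : (X \ {U, V, W, a₁, b₁, a₂, b₂, a₃, b₃}).ncard = 1 := by
    have hsub : ({U, V, W, a₁, b₁, a₂, b₂, a₃, b₃} : Set Pt) ⊆ X := by
      intro x hx
      simp only [Set.mem_insert_iff, Set.mem_singleton_iff] at hx
      rcases hx with rfl | rfl | rfl | rfl | rfl | rfl | rfl | rfl | rfl
      exacts [hUX, hVX, hWX, ha₁.1, hb₁.1, ha₂.1, hb₂.1, ha₃.1, hb₃.1]
    have h9 : ({U, V, W, a₁, b₁, a₂, b₂, a₃, b₃} : Set Pt).ncard = 9 := by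
      repeat rw [Set.ncard_insert_of_notMem (by
        simp only [Set.mem_insert_iff, Set.mem_singleton_iff]
        grind)]
      rw [Set.ncard_singleton]
    rw [Set.ncard_sdiff hsub, h9, hX.1.1]
  obtain ⟨O, hO⟩ := Set.ncard_eq_one.1 hcard
  have hOiff : ∀ x, (x ∈ X ∧ ¬(x = U ∨ x = V ∨ x = W ∨ x = a₁ ∨ x = b₁ ∨ x = a₂ ∨ x = b₂ ∨
      x = a₃ ∨ x = b₃)) ↔ x = O := fun x => by
    simpa only [Set.mem_sdiff, Set.mem_insert_iff, Set.mem_singleton_iff] using Set.ext_iff.1 hO x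
  obtain ⟨hOX, hO9⟩ := (hOiff O).2 rfl
  have hOM : O ∉ M := fun h => hO9 (by
    rcases (hXM O).1 ⟨hOX, h⟩ with e | e | e | e <;> simp [e])
  have hON : O ∉ N := fun h => hO9 (by
    rcases (hXN O).1 ⟨hOX, h⟩ with e | e | e | e <;> simp [e])
  have hOK : O ∉ K := fun h => hO9 (by
    rcases (hXK O).1 ⟨hOX, h⟩ with e | e | e | e <;> simp [e])
  have hcov : ∀ x ∈ X, x = O ∨ x ∈ M ∨ x ∈ N ∨ x ∈ K := by
    intro x hx
    by_cases h : x = O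
    · exact Or.inl h
    · have := not_imp_comm.1 (fun h9 => (hOiff x).1 ⟨hx, h9⟩) h
      right
      rcases this with rfl | rfl | rfl | rfl | rfl | rfl | rfl | rfl | rfl
      exacts [Or.inl hUM, Or.inl hVM, Or.inr (Or.inl hWN), Or.inl ha₁.2, Or.inl hb₁.2,
        Or.inr (Or.inl ha₂.2), Or.inr (Or.inl hb₂.2), Or.inr (Or.inr ha₃.2),
        Or.inr (Or.inr hb₃.2)]
  have hmem₁ : ∀ x, x = a₁ ∨ x = b₁ → (x ∈ X ∧ x ≠ O) ∧ x ∈ M ∧ x ∉ N ∧ x ∉ K := by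
    rintro x (rfl | rfl)
    exacts [⟨⟨ha₁.1, fun e => hOM (e ▸ ha₁.2)⟩, ha₁.2, ha₁NK⟩,
      ⟨⟨hb₁.1, fun e => hOM (e ▸ hb₁.2)⟩, hb₁.2, hb₁NK⟩]
  have hmem₂ : ∀ x, x = a₂ ∨ x = b₂ → (x ∈ X ∧ x ≠ O) ∧ x ∈ N ∧ x ∉ K ∧ x ∉ M := by
    rintro x (rfl | rfl)
    exacts [⟨⟨ha₂.1, fun e => hON (e ▸ ha₂.2)⟩, ha₂.2, ha₂KM⟩,
      ⟨⟨hb₂.1, fun e => hON (e ▸ hb₂.2)⟩, hb₂.2, hb₂KM⟩]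
  have hmem₃ : ∀ x, x = a₃ ∨ x = b₃ → (x ∈ X ∧ x ≠ O) ∧ x ∈ K ∧ x ∉ M ∧ x ∉ N := by
    rintro x (rfl | rfl)
    exacts [⟨⟨ha₃.1, fun e => hOK (e ▸ ha₃.2)⟩, ha₃.2, ha₃MN⟩,
      ⟨⟨hb₃.1, fun e => hOK (e ▸ hb₃.2)⟩, hb₃.2, hb₃MN⟩]
  have htrans : ∀ L x y z, IsLine L → O ∈ L → x ∈ L → y ∈ L → z ∈ L →
      x = a₁ ∨ x = b₁ → y = a₂ ∨ y = b₂ → z = a₃ ∨ z = b₃ → False := by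
    intro L x y z hL hOL hxL hyL hzL hx hy hz
    have h := hL.isMaxLine_of_mem hM.1 hN.1 hK.1 hcov hOX hOM hON hOK hOL
      ⟨(hmem₁ x hx).1.1, (hmem₁ x hx).2.1, (hmem₁ x hx).2.2.1⟩
      ⟨(hmem₂ y hy).1.1, (hmem₂ y hy).2.1, (hmem₂ y hy).2.2.1⟩
      ⟨(hmem₃ z hz).1.1, (hmem₃ z hz).2.1, (hmem₃ z hz).2.2.1⟩ hxL hyL hzL
    rcases (hmaxiff L).1 h with rfl | rfl | rfl
    exacts [hOM hOL, hON hOL, hOK hOL]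
  obtain ⟨P₁, Q₁, Q₂, P₂, L₁, S₁, hPQ₁, hQP₂, hL₁, hS₁, -, hVS₁, hmemL₁, hmemS₁, huseV⟩ :=
    hX.exists_lines_of_vertex hM.1 hN.1 hK hVX hVM hVN hVK hOX hOM hOK hab₁ hab₂
      ⟨ha₁, ha₁V, ha₁NK.2⟩ ⟨hb₁, hb₁V, hb₁NK.2⟩ ⟨ha₂, ha₂V, ha₂KM.1⟩ ⟨hb₂, hb₂V, hb₂KM.1⟩
  obtain ⟨c₂, d₂, Q₃, P₃, L₂, S₂, hcd₂, hQP₃, hL₂, hS₂, -, hWS₂, hmemL₂, hmemS₂, huseW⟩ :=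
    hX.exists_lines_of_vertex hN.1 hK.1 hM hWX hWN hWK hWM hOX hON hOM hab₂ hab₃
      ⟨ha₂, ha₂W, ha₂KM.2⟩ ⟨hb₂, hb₂W, hb₂KM.2⟩ ⟨ha₃, ha₃W, ha₃MN.1⟩ ⟨hb₃, hb₃W, hb₃MN.1⟩
  obtain ⟨c₃, d₃, c₁, d₁, L₃, S₃, hcd₃, hcd₁, hL₃, hS₃, -, hUS₃, hmemL₃, hmemS₃, huseU⟩ :=
    hX.exists_lines_of_vertex hK.1 hM.1 hN hUX hUK hUM hUN hOX hOK hON hab₃ hab₁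
      ⟨ha₃, ha₃U, ha₃MN.2⟩ ⟨hb₃, hb₃U, hb₃MN.2⟩ ⟨ha₁, ha₁U, ha₁NK.1⟩ ⟨hb₁, hb₁U, hb₁NK.1⟩
  have hP₁' : P₁ = a₁ ∨ P₁ = b₁ := hPQ₁.imp And.left And.left
  have hQ₁' : Q₁ = a₁ ∨ Q₁ = b₁ := hPQ₁.symm.imp And.right And.right
  have hP₂' : P₂ = a₂ ∨ P₂ = b₂ := hQP₂.symm.imp And.right And.right
  have hQ₂' : Q₂ = a₂ ∨ Q₂ = b₂ := hQP₂.imp And.left And.left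
  have hP₃' : P₃ = a₃ ∨ P₃ = b₃ := hQP₃.symm.imp And.right And.right
  have hQ₃' : Q₃ = a₃ ∨ Q₃ = b₃ := hQP₃.imp And.left And.left
  have hPQ₁ne : P₁ ≠ Q₁ := ne_of_relabel hPQ₁ hab₁
  have hPQ₂ne : P₂ ≠ Q₂ := (ne_of_relabel hQP₂ hab₂).symm
  have hPQ₃ne : P₃ ≠ Q₃ := (ne_of_relabel hQP₃ hab₃).symm
  obtain ⟨rfl, rfl⟩ : c₂ = P₂ ∧ d₂ = Q₂ := by
    have hne : c₂ ≠ Q₂ := by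
      rintro rfl
      have e := hL₁.eq_of_mem_s8 hL₂ (hmem₂ _ hQ₂').1.2 hmemL₁.2.2 hmemL₁.1 hmemL₂.2.1 hmemL₂.1
      exact htrans L₁ P₁ _ Q₃ hL₁ hmemL₁.1 hmemL₁.2.1 hmemL₁.2.2 (e ▸ hmemL₂.2.2) hP₁' hQ₂' hQ₃'
    exact eq_and_eq_of_relabel (hQP₂.symm.imp And.symm And.symm) hcd₂ hne
  obtain ⟨rfl, rfl⟩ : c₃ = P₃ ∧ d₃ = Q₃ := by
    have hne : c₃ ≠ Q₃ := by
      rintro rfl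
      have e := hL₂.eq_of_mem_s8 hL₃ (hmem₃ _ hQ₃').1.2 hmemL₂.2.2 hmemL₂.1 hmemL₃.2.1 hmemL₃.1
      exact htrans L₂ c₁ c₂ _ hL₂ hmemL₂.1 (e ▸ hmemL₃.2.2) hmemL₂.2.1 hmemL₂.2.2
        (hcd₁.imp And.left And.left) hP₂' hQ₃'
    exact eq_and_eq_of_relabel (hQP₃.symm.imp And.symm And.symm) hcd₃ hne
  obtain ⟨rfl, rfl⟩ : c₁ = Q₁ ∧ d₁ = P₁ := by
    have hne : c₁ ≠ P₁ := by
      rintro rfl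
      have e := hL₃.eq_of_mem_s8 hL₁ (hmem₁ _ hP₁').1.2 hmemL₃.2.2 hmemL₃.1 hmemL₁.2.1 hmemL₁.1
      exact htrans L₃ _ d₂ c₃ hL₃ hmemL₃.1 hmemL₃.2.2 (e ▸ hmemL₁.2.2) hmemL₃.2.1 hP₁' hQ₂' hP₃'
    exact eq_and_eq_of_relabel (hPQ₁.symm.imp And.symm And.symm) hcd₁ hne
  have huse : ∀ (M N L : Set Pt) (p q : Pt), IsMaxLine 3 X M → IsMaxLine 3 X N → M ≠ N →
      IsLine L → O ∈ L → q ∈ L → O ∉ M → O ∉ N → p ≠ q → (p ∈ X ∧ p ≠ O) ∧ p ∉ M ∧ p ∉ N →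
      (q ∈ X ∧ q ≠ O) ∧ q ∉ M ∧ q ∉ N →
      ∀ ℓ, IsLine ℓ → (Uses 3 X ℓ p ↔ ℓ = M ∨ ℓ = N ∨ ℓ = L) := by
    intro M N L p q hM hN hMN hL hOL hqL hOM hON hpq hp hq
    obtain ⟨c, hc, -, hcov, hiff⟩ :=
      hX.exists_line_of_notMem_of_notMem hM hN hMN hp.1.1 hp.2.1 hp.2.2
    rw [hL.eq_of_mem_s8 hc hq.1.2 hqL hOL (hcov q hq.1.1 hpq.symm hq.2.1 hq.2.2)
      (hcov O hOX hp.1.2.symm hOM hON)]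
    exact hiff
  have mP₁ := hmem₁ _ hP₁'
  have mQ₁ := hmem₁ _ hQ₁'
  have mP₂ := hmem₂ _ hP₂'
  have mQ₂ := hmem₂ _ hQ₂'
  have mP₃ := hmem₃ _ hP₃'
  have mQ₃ := hmem₃ _ hQ₃'
  refine ⟨M, N, K, V, W, U, O, d₁, c₁, c₂, d₂, c₃, d₃, L₁, L₂, L₃, S₁, S₂, S₃, ?_⟩
  exact
    { isMaxLine_M := hM
      isMaxLine_N := hN
      isMaxLine_K := hK
      mem_X := fun x => by
        rw [or_iff_of_relabel hPQ₁, or_iff_of_relabel hcd₂, or_iff_of_relabel hcd₃, ← hXM, ← hXN, ← hXK]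
        constructor
        · intro hx
          rcases hcov x hx with h | h | h | h
          exacts [Or.inl h, Or.inr (Or.inl ⟨hx, h⟩), Or.inr (Or.inr (Or.inl ⟨hx, h⟩)),
            Or.inr (Or.inr (Or.inr ⟨hx, h⟩))]
        · rintro (rfl | h | h | h)
          exacts [hOX, h.1, h.1, h.1]
      O_notMem := ⟨hOM, hON, hOK⟩
      V_mem := ⟨hVM, hVN, hVK⟩
      W_mem := ⟨hWN, hWK, hWM⟩
      U_mem := ⟨hUK, hUM, hUN⟩
      P₁_mem := mP₁.2
      Q₁_mem := mQ₁.2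
      P₂_mem := mP₂.2
      Q₂_mem := mQ₂.2
      P₃_mem := mP₃.2
      Q₃_mem := mQ₃.2
      P₁_ne_Q₁ := hPQ₁ne
      P₂_ne_Q₂ := hPQ₂ne
      P₃_ne_Q₃ := hPQ₃ne
      isLine_L₁ := hL₁
      isLine_L₂ := hL₂
      isLine_L₃ := hL₃
      isLine_S₁ := hS₁
      isLine_S₂ := hS₂
      isLine_S₃ := hS₃
      mem_L₁ := hmemL₁
      mem_L₂ := hmemL₂
      mem_L₃ := hmemL₃
      mem_S₁ := ⟨hmemS₁.1, hmemS₁.2, hVS₁⟩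
      mem_S₂ := ⟨hmemS₂.1, hmemS₂.2, hWS₂⟩
      mem_S₃ := ⟨hmemS₃.1, hmemS₃.2, hUS₃⟩
      not_transversal := fun L x y z hL hOL hxL hyL hzL hx hy hz =>
        htrans L x y z hL hOL hxL hyL hzL (by rcases hx with rfl | rfl <;> assumption)
          (by rcases hy with rfl | rfl <;> assumption) (by rcases hz with rfl | rfl <;> assumption)
      uses_O := fun ℓ hℓ => hX.uses_iff_of_notMem hM hN hK hMN hMK hNK hOX hOM hON hOK hℓ
      uses_V := huseV
      uses_W := huseW
      uses_U := huseU
      uses_P₁ := huse N K L₃ _ _ hN hK hNK hL₃ hmemL₃.1 hmemL₃.2.2 hON hOK hPQ₁ne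
        ⟨mP₁.1, mP₁.2.2⟩ ⟨mQ₁.1, mQ₁.2.2⟩
      uses_Q₁ := huse N K L₁ _ _ hN hK hNK hL₁ hmemL₁.1 hmemL₁.2.1 hON hOK hPQ₁ne.symm
        ⟨mQ₁.1, mQ₁.2.2⟩ ⟨mP₁.1, mP₁.2.2⟩
      uses_P₂ := huse K M L₁ _ _ hK hM hMK.symm hL₁ hmemL₁.1 hmemL₁.2.2 hOK hOM hPQ₂ne
        ⟨mP₂.1, mP₂.2.2⟩ ⟨mQ₂.1, mQ₂.2.2⟩
      uses_Q₂ := huse K M L₂ _ _ hK hM hMK.symm hL₂ hmemL₂.1 hmemL₂.2.1 hOK hOM hPQ₂ne.symm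
        ⟨mQ₂.1, mQ₂.2.2⟩ ⟨mP₂.1, mP₂.2.2⟩
      uses_P₃ := huse M N L₂ _ _ hM hN hMN hL₂ hmemL₂.1 hmemL₂.2.2 hOM hON hPQ₃ne
        ⟨mP₃.1, mP₃.2.2⟩ ⟨mQ₃.1, mQ₃.2.2⟩
      uses_Q₃ := huse M N L₃ _ _ hM hN hMN hL₃ hmemL₃.1 hmemL₃.2.1 hOM hON hPQ₃ne.symm
        ⟨mQ₃.1, mQ₃.2.2⟩ ⟨mP₃.1, mP₃.2.2⟩ }

/-- If a `GC_3` set `X` has exactly three maximal lines, then every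
`3`-node line of `X` is used by exactly `3` nodes or by no node of `X`. -/
theorem GC3_three_maxLines_useSet_card (X : Set Pt) (hX : IsGC 3 X)
    (hmax : {M : Set Pt | IsMaxLine 3 X M}.ncard = 3) :
    ∀ ℓ : Set Pt, IsNodeLine 3 X ℓ →
      (UseSet 3 X ℓ).ncard = 3 ∨ (UseSet 3 X ℓ).ncard = 0 := by
  obtain ⟨_, _, _, _, _, _, _, _, _, _, _, _, _, _, _, _, _, _, _, h⟩ :=
    hX.exists_triangleConfig hmax
  exact fun ℓ hℓ => h.ncard_useSet hℓ
end
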